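/- arXiv:2211.11477 — 7 statements merged into one kernel-verified Lean document; each statement's English description precedes it below -/
import Mathlib

section
/- Let C be a k-dimensional F_{q^n}-subspace of the coefficient space F_{q^n}^{mn} with F_{q^n}-basis (g_1, …, g_k). Then the following are equivalent: (a) the F_q-subspace U = {(g_1(v), …, g_k(v)) : v ∈ (F_{q^n})^m} of (F_{q^n})^k has F_q-dimension nm; (b) the intersection of the kernels of the evaluation maps of g_1, …, g_k is {0}; (c) the intersection of the kernels of the evaluation maps of all f ∈ C is {0}; (d) every nonzero element of the dual C^⊥ = {f ∈ F_{q^n}^{mn} : f ⋆ g = 0 for all g ∈ C} has evaluation map of rank at least 2. -/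
/-- Evaluation of the multivariate linearized polynomial with coefficient tuple `f`
at the point `v ∈ (F_{q^n})^m`: `f(v) = ∑_{i,j} f_{i,j} v_i^{q^j}`. -/
def linEval (q : ℕ) {m n : ℕ} {Fqn : Type*} [Field Fqn]
    (f : Fin m → Fin n → Fqn) (v : Fin m → Fqn) : Fqn :=
  ∑ i : Fin m, ∑ j : Fin n, f i j * (v i) ^ q ^ (j : ℕ)

section LinEval

variable (K : Type*) {L : Type*} [Field K] [Fintype K] [Field L] [Algebra K L] {m n : ℕ}

/-- The evaluation map of a multivariate linearized polynomial, as a linear map over the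
base field. -/
def linEvalHom (f : Fin m → Fin n → L) : (Fin m → L) →ₗ[K] L :=
  ∑ i, ∑ j : Fin n,
    (LinearMap.mulLeft K (f i j)) ∘ₗ
      (FiniteField.frobeniusAlgHom K L ^ (j : ℕ)).toLinearMap ∘ₗ LinearMap.proj i

theorem linEvalHom_apply (f : Fin m → Fin n → L) (v : Fin m → L) :
    linEvalHom K f v = linEval (Fintype.card K) f v := by
  simp [linEvalHom, linEval, AlgHom.coe_pow, FiniteField.coe_frobeniusAlgHom, pow_iterate]

theorem linEval_single (q : ℕ) (hq : q ≠ 0) (f : Fin m → Fin n → L) (i : Fin m) (x : L) :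
    linEval q f (Pi.single i x) = ∑ j, f i j * x ^ q ^ (j : ℕ) := by
  rw [linEval, Finset.sum_eq_single i]
  · simp
  · intro i' _ hi'
    simp [Pi.single_eq_of_ne hi', hq]
  · simp

theorem span_range_linEval (f : Fin m → Fin n → L) :
    Submodule.span K (Set.range (linEval (Fintype.card K) f)) = (linEvalHom K f).range := by
  rw [← Submodule.span_eq (linEvalHom K f).range, LinearMap.coe_range]
  congr 2
  exact funext fun v ↦ (linEvalHom_apply K f v).symm

variable [FiniteDimensional K L]

theorem eq_of_linEval_eq {f f' : Fin m → Fin (Module.finrank K L) → L}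
    (h : linEval (Fintype.card K) f = linEval (Fintype.card K) f') : f = f' := by
  have := Module.finite_of_finite K (M := L)
  have hli := (linearIndependent_algHom_toLinearMap K L L).comp _
    (FiniteField.bijective_frobeniusAlgHom_pow K L).1
  ext i j
  refine sub_eq_zero.mp <| Fintype.linearIndependent_iff.mp hli (fun j ↦ f i j - f' i j) ?_ j
  ext x
  have hx := congrFun h (Pi.single i x)
  rw [linEval_single _ Fintype.card_ne_zero, linEval_single _ Fintype.card_ne_zero,
    ← sub_eq_zero, ← Finset.sum_sub_distrib] at hx
  simpa [AlgHom.coe_pow, FiniteField.coe_frobeniusAlgHom, pow_iterate, sub_mul] using hx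

theorem algebraMap_trace_eq_sum_fin (x : L) :
    algebraMap K L (Algebra.trace K L x) =
      ∑ j : Fin (Module.finrank K L), x ^ Fintype.card K ^ (j : ℕ) := by
  have := Module.finite_of_finite K (M := L)
  rw [FiniteField.algebraMap_trace_eq_sum_pow, Finset.sum_range, Nat.card_eq_fintype_card]

theorem linEval_mul_pow_eq_mul_trace (β : L) (α v : Fin m → L) :
    linEval (Fintype.card K)
        (fun i (j : Fin (Module.finrank K L)) ↦ β * α i ^ Fintype.card K ^ (j : ℕ)) v =
      β * algebraMap K L (∑ i, Algebra.trace K L (α i * v i)) := by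
  simp only [linEval, map_sum, algebraMap_trace_eq_sum_fin, Finset.mul_sum, mul_pow, mul_assoc]

/-- Every linear functional on `L ^ m` is a sum of traces. -/
theorem exists_eq_sum_trace (φ : (Fin m → L) →ₗ[K] K) :
    ∃ α : Fin m → L, ∀ v, φ v = ∑ i, Algebra.trace K L (α i * v i) := by
  classical
  refine ⟨fun i ↦ ((Algebra.traceForm K L).toDual (traceForm_nondegenerate K L)).symm
    (φ ∘ₗ LinearMap.single K (fun _ ↦ L) i), fun v ↦ ?_⟩
  simp_rw [← Algebra.traceForm_apply, LinearMap.BilinForm.apply_toDual_symm_apply]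
  conv_lhs => rw [← Finset.univ_sum_single v, map_sum]
  rfl

/-- A linearized polynomial of rank at most one is a multiple of a trace form. -/
theorem exists_eq_mul_pow_of_finrank_range_le_one {f : Fin m → Fin (Module.finrank K L) → L}
    (hf : Module.finrank K (linEvalHom K f).range ≤ 1) :
    ∃ (β : L) (α : Fin m → L), f = fun i (j : Fin _) ↦ β * α i ^ Fintype.card K ^ (j : ℕ) := by
  obtain ⟨⟨β, hβ⟩, h⟩ := finrank_le_one_iff.mp hf
  have h' (v) : ∃ c : K, algebraMap K L c * β = linEvalHom K f v := by
    obtain ⟨c, hc⟩ := h ⟨_, LinearMap.mem_range_self _ v⟩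
    exact ⟨c, by simpa [Algebra.smul_def] using congrArg Subtype.val hc⟩
  choose φ hφ using h'
  by_cases hβ0 : β = 0
  · refine ⟨0, 0, eq_of_linEval_eq K (funext fun v ↦ ?_)⟩
    rw [← linEvalHom_apply, ← hφ, hβ0]
    simp [linEval]
  · let ψ : (Fin m → L) →ₗ[K] K :=
      { toFun := φ
        map_add' := fun v w ↦ (algebraMap K L).injective <| mul_right_cancel₀ hβ0 <| by
          rw [hφ, map_add, map_add, add_mul, hφ, hφ]
        map_smul' := fun c v ↦ (algebraMap K L).injective <| mul_right_cancel₀ hβ0 <| by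
          rw [hφ, map_smul, RingHom.id_apply, smul_eq_mul, map_mul, mul_assoc, hφ,
            Algebra.smul_def] }
    obtain ⟨α, hα⟩ := exists_eq_sum_trace K ψ
    refine ⟨β, α, eq_of_linEval_eq K (funext fun v ↦ ?_)⟩
    rw [linEval_mul_pow_eq_mul_trace, ← hα, ← linEvalHom_apply, ← hφ, mul_comm]
    rfl

theorem finrank_range_linEvalHom_mul_pow_le_one (α : Fin m → L) :
    Module.finrank K (linEvalHom K fun i (j : Fin (Module.finrank K L)) ↦
      α i ^ Fintype.card K ^ (j : ℕ)).range ≤ 1 := by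
  refine (Submodule.finrank_mono (t := Submodule.span K {1}) ?_).trans
    (by simpa using finrank_span_le_card (R := K) ({1} : Set L))
  rintro _ ⟨v, rfl⟩
  have h := linEval_mul_pow_eq_mul_trace K 1 α v
  simp only [one_mul] at h
  rw [linEvalHom_apply, h]
  exact Submodule.mem_span_singleton.mpr ⟨_, (Algebra.algebraMap_eq_smul_one _).symm⟩

end LinEval

/-- For a `k`-dimensional `F_{q^n}`-subspace `C` of the coefficient
space with basis `g₁, …, g_k`, the following are equivalent:
(a) the `F_q`-subspace `U = {(g₁(v),…,g_k(v)) : v}` has `F_q`-dimension `nm`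
    (`C` is nondegenerate);
(b) the kernels of the evaluation maps of the `gₗ` intersect trivially;
(c) the kernels of the evaluation maps of all `f ∈ C` intersect trivially;
(d) every nonzero `f` in the dual `C^⊥ = {f : f ⋆ g = 0 ∀ g ∈ C}` has evaluation
    map of rank at least `2`. -/
theorem nondegenerate_tfae
    (q n m k : ℕ) (hn : 0 < n) (hm : 0 < m) (hk : 0 < k)
    (Fq Fqn : Type*) [Field Fq] [Fintype Fq] [Field Fqn] [Algebra Fq Fqn]
    (hq : Fintype.card Fq = q) (hrank : Module.finrank Fq Fqn = n)
    (C : Submodule Fqn (Fin m → Fin n → Fqn))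
    (g : Fin k → (Fin m → Fin n → Fqn))
    (hg_indep : LinearIndependent Fqn g)
    (hg_span : Submodule.span Fqn (Set.range g) = C) :
    List.TFAE [
      -- (a) the effective length of `C` is `nm`
      Module.finrank Fq (Submodule.span Fq
        {w : Fin k → Fqn | ∃ v : Fin m → Fqn, w = fun l => linEval q (g l) v}) = n * m,
      -- (b)
      (⋂ l : Fin k, {v : Fin m → Fqn | linEval q (g l) v = 0}) = {0},
      -- (c)
      (⋂ f ∈ (C : Set (Fin m → Fin n → Fqn)), {v : Fin m → Fqn | linEval q f v = 0})
        = {0},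
      -- (d) every nonzero element of `C^⊥` has rank at least 2
      ∀ f : Fin m → Fin n → Fqn,
        (∀ g' ∈ C, (∑ i : Fin m, ∑ j : Fin n, f i j * g' i j) = 0) → f ≠ 0 →
        2 ≤ Module.finrank Fq
          (Submodule.span Fq (Set.range (linEval q f)))
    ] := by
  subst hq hrank
  have : FiniteDimensional Fq Fqn := Module.finite_of_finrank_pos hn
  set q := Fintype.card Fq
  have linEval_zero (f : Fin m → Fin (Module.finrank Fq Fqn) → Fqn) : linEval q f 0 = 0 := by
    rw [← linEvalHom_apply, map_zero]
  tfae_have 1 ↔ 2 := by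
    let φ : (Fin m → Fqn) →ₗ[Fq] (Fin k → Fqn) := LinearMap.pi fun l ↦ linEvalHom Fq (g l)
    have hφ (v) : φ v = fun l ↦ linEval q (g l) v := funext fun l ↦ linEvalHom_apply Fq (g l) v
    have hU : {w : Fin k → Fqn | ∃ v : Fin m → Fqn, w = fun l => linEval q (g l) v} =
        φ.range := by
      ext w
      simp [hφ, eq_comm]
    have hker : (⋂ l : Fin k, {v : Fin m → Fqn | linEval q (g l) v = 0}) = φ.ker := by
      ext v
      simp [hφ, funext_iff]
    have hdim : Module.finrank Fq (Fin m → Fqn) = Module.finrank Fq Fqn * m := by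
      simp [Module.finrank_pi_fintype, mul_comm]
    have hrn := φ.finrank_range_add_finrank_ker
    rw [hU, Submodule.span_eq, hker, ← Submodule.bot_coe (R := Fq), SetLike.coe_set_eq,
      ← Submodule.finrank_eq_zero (R := Fq)]
    omega
  tfae_have 2 ↔ 3 := by
    suffices h : (⋂ l : Fin k, {v : Fin m → Fqn | linEval q (g l) v = 0}) =
        ⋂ f ∈ (C : Set (Fin m → Fin (Module.finrank Fq Fqn) → Fqn)),
          {v : Fin m → Fqn | linEval q f v = 0} by rw [h]
    ext v
    simp only [Set.mem_iInter, Set.mem_ofPred_eq, SetLike.mem_coe]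
    refine ⟨fun h f hf ↦ ?_, fun h l ↦ h _ (hg_span ▸ Submodule.subset_span ⟨l, rfl⟩)⟩
    rw [← hg_span] at hf
    induction hf using Submodule.span_induction with
    | mem f hf => obtain ⟨l, rfl⟩ := hf; exact h l
    | zero => simp [linEval]
    | add f f' _ _ hf hf' =>
      simpa [linEval, add_mul, Finset.sum_add_distrib, hf] using congrArg₂ (· + ·) hf hf'
    | smul c f _ hf =>
      simpa [linEval, mul_assoc, Finset.mul_sum] using congrArg (c * ·) hf
  tfae_have 3 → 4 := by
    intro h f hf hf0
    by_contra! hlt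
    rw [span_range_linEval] at hlt
    obtain ⟨β, α, rfl⟩ := exists_eq_mul_pow_of_finrank_range_le_one Fq (Nat.le_of_lt_succ hlt)
    have hβ : β ≠ 0 := fun hβ ↦ hf0 (by ext; simp [hβ])
    refine hf0 ?_
    have hα : α ∈ ({0} : Set (Fin m → Fqn)) := by
      rw [← h]
      simp only [Set.mem_iInter, Set.mem_ofPred_eq, SetLike.mem_coe]
      intro f hfC
      have := hf f hfC
      simp only [mul_assoc, ← Finset.mul_sum] at this
      simpa [linEval, mul_comm] using (mul_eq_zero.mp this).resolve_left hβ
    rw [Set.mem_singleton_iff.mp hα]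
    ext
    simp
  tfae_have 4 → 3 := by
    intro h
    refine Set.Subset.antisymm (fun α hα ↦ ?_) (by simp [linEval_zero])
    simp only [Set.mem_iInter, Set.mem_ofPred_eq, SetLike.mem_coe] at hα
    by_contra hα0
    have := h (fun i j ↦ α i ^ q ^ (j : ℕ))
      (fun f hf ↦ by simpa [linEval, mul_comm] using hα f hf)
      (fun h0 ↦ hα0 (funext fun i ↦ by simpa using congrFun₂ h0 i ⟨0, hn⟩))
    rw [span_range_linEval] at this
    exact absurd (this.trans (finrank_range_linEvalHom_mul_pow_le_one Fq α)) (by norm_num)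
  tfae_finish
end

section
/- Let r, n be positive integers with rn even, let V = F_{q^n}^r, let σ : V × V → F_{q^n} be a nondegenerate F_{q^n}-bilinear form, and let σ'(u, v) := Tr_{q^n/q}(σ(u, v)), a nondegenerate F_q-bilinear form on V regarded as an rn-dimensional F_q-vector space. For an F_{q^n}-subspace R of V write R^τ = {v ∈ V : σ(u, v) = 0 for all u ∈ R}, and for an F_q-subspace U of V write U^{τ'} = {v ∈ V : σ'(u, v) = 0 for all u ∈ U}. Suppose U is a scattered F_q-subspace of V with dim_{F_q}(U) = rn/2, and suppose there exist an integer i with 2 ≤ i ≤ r/2 and F_{q^n}-subspaces V_1, V_2 with V = V_1 ⊕ V_2, dim_{F_{q^n}}(V_1) = i, dim_{F_q}(U ∩ V_1) = in/2 and dim_{F_q}(U ∩ V_2) = (r−i)n/2. Then V = V_1^τ ⊕ V_2^τ, dim_{F_q}(U^{τ'} ∩ V_1^τ) = (r−i)n/2 and dim_{F_q}(U^{τ'} ∩ V_2^τ) = in/2. -/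
section PerpDefs

variable {Fq Fqn : Type*} [Field Fq] [Fintype Fq] [Field Fqn] [Algebra Fq Fqn] {r : ℕ}

/-- The orthogonal complement `R^τ` of an `F_{q^n}`-subspace `R` with respect to the
`F_{q^n}`-bilinear form `σ`. -/
def tauPerp (σ : (Fin r → Fqn) →ₗ[Fqn] (Fin r → Fqn) →ₗ[Fqn] Fqn)
    (R : Submodule Fqn (Fin r → Fqn)) : Submodule Fqn (Fin r → Fqn) where
  carrier := {v | ∀ u ∈ R, σ u v = 0}
  zero_mem' := by intro u _; simp
  add_mem' := by
    intro a b ha hb u hu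
    rw [map_add, ha u hu, hb u hu, add_zero]
  smul_mem' := by
    intro c v hv u hu
    rw [map_smul, hv u hu, smul_zero]

/-- The orthogonal complement `U^{τ'}` of an `F_q`-subspace `U` with respect to the
`F_q`-bilinear form `σ' = Tr_{q^n/q} ∘ σ`. -/
def tauPerp' (σ : (Fin r → Fqn) →ₗ[Fqn] (Fin r → Fqn) →ₗ[Fqn] Fqn)
    (U : Submodule Fq (Fin r → Fqn)) : Submodule Fq (Fin r → Fqn) where
  carrier := {v | ∀ u ∈ U, Algebra.trace Fq Fqn (σ u v) = 0}
  zero_mem' := by intro u _; simp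
  add_mem' := by
    intro a b ha hb u hu
    rw [map_add, map_add, ha u hu, hb u hu, add_zero]
  smul_mem' := by
    intro c v hv u hu
    rw [LinearMap.map_smul_of_tower, map_smul, hv u hu, smul_zero]

end PerpDefs

/-- In a finite-dimensional space, a subspace and its right orthogonal complement under a
left-nondegenerate bilinear form have complementary dimensions. -/
theorem finrank_add_finrank_of_mem_iff_forall_eq_zero {K V : Type*} [Field K] [AddCommGroup V]
    [Module K V] [FiniteDimensional K V] (B : V →ₗ[K] Module.Dual K V)
    (hB : Function.Injective B) (W P : Submodule K V)
    (hP : ∀ v, v ∈ P ↔ ∀ u ∈ W, B u v = 0) :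
    Module.finrank K W + Module.finrank K P = Module.finrank K V := by
  have h : P = (W.map B).dualCoannihilator := by
    ext v
    simp [hP, Submodule.mem_dualCoannihilator]
  rw [h, (Submodule.equivMapOfInjective B hB W).finrank_eq]
  exact Subspace.finrank_add_finrank_dualCoannihilator_eq _

section

variable {Fq Fqn : Type*} [Field Fq] [Field Fqn] [Algebra Fq Fqn]

theorem eq_zero_of_forall_trace_mul_eq_zero [FiniteDimensional Fq Fqn]
    [Algebra.IsSeparable Fq Fqn] {c : Fqn}
    (h : ∀ a : Fqn, Algebra.trace Fq Fqn (a * c) = 0) : c = 0 :=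
  (traceForm_nondegenerate Fq Fqn).2 c h

variable {r : ℕ}

/-- The `F_q`-bilinear form `Tr_{q^n/q} ∘ σ`. -/
noncomputable def traceBilin (Fq : Type*) {Fqn : Type*} [Field Fq] [Field Fqn] [Algebra Fq Fqn] {r : ℕ}
    (σ : (Fin r → Fqn) →ₗ[Fqn] (Fin r → Fqn) →ₗ[Fqn] Fqn) :
    (Fin r → Fqn) →ₗ[Fq] Module.Dual Fq (Fin r → Fqn) :=
  LinearMap.mk₂ Fq (fun u v => Algebra.trace Fq Fqn (σ u v))
    (by intros; simp)
    (by
      intro c u v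
      rw [LinearMap.map_smul_of_tower, LinearMap.smul_apply, map_smul])
    (by intros; simp)
    (by
      intro c u v
      rw [LinearMap.map_smul_of_tower, map_smul])

@[simp]
theorem traceBilin_apply (σ : (Fin r → Fqn) →ₗ[Fqn] (Fin r → Fqn) →ₗ[Fqn] Fqn)
    (u v : Fin r → Fqn) : traceBilin Fq σ u v = Algebra.trace Fq Fqn (σ u v) :=
  rfl

theorem traceBilin_injective [FiniteDimensional Fq Fqn] [Algebra.IsSeparable Fq Fqn]
    {σ : (Fin r → Fqn) →ₗ[Fqn] (Fin r → Fqn) →ₗ[Fqn] Fqn}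
    (hσ : ∀ u : Fin r → Fqn, (∀ v : Fin r → Fqn, σ u v = 0) → u = 0) :
    Function.Injective (traceBilin Fq σ) := by
  rw [injective_iff_map_eq_zero]
  refine fun u hu => hσ u fun v => eq_zero_of_forall_trace_mul_eq_zero (Fq := Fq) fun a => ?_
  simpa using LinearMap.congr_fun hu (a • v)

theorem mem_tauPerp_iff_forall_trace_eq_zero [FiniteDimensional Fq Fqn]
    [Algebra.IsSeparable Fq Fqn] (σ : (Fin r → Fqn) →ₗ[Fqn] (Fin r → Fqn) →ₗ[Fqn] Fqn)
    (R : Submodule Fqn (Fin r → Fqn)) (v : Fin r → Fqn) :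
    v ∈ tauPerp σ R ↔ ∀ u ∈ R, Algebra.trace Fq Fqn (σ u v) = 0 := by
  refine ⟨fun h u hu => by rw [h u hu, map_zero], fun h u hu => ?_⟩
  refine eq_zero_of_forall_trace_mul_eq_zero (Fq := Fq) fun a => ?_
  simpa using h (a • u) (R.smul_mem a hu)

theorem finrank_add_finrank_tauPerp
    {σ : (Fin r → Fqn) →ₗ[Fqn] (Fin r → Fqn) →ₗ[Fqn] Fqn}
    (hσ : ∀ u : Fin r → Fqn, (∀ v : Fin r → Fqn, σ u v = 0) → u = 0)
    (R : Submodule Fqn (Fin r → Fqn)) :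
    Module.finrank Fqn R + Module.finrank Fqn (tauPerp σ R) = r := by
  have h := finrank_add_finrank_of_mem_iff_forall_eq_zero σ
    ((injective_iff_map_eq_zero σ).2 fun u hu => hσ u fun v => by rw [hu]; rfl)
    R (tauPerp σ R) fun v => Iff.rfl
  rwa [Module.finrank_fin_fun] at h

theorem isCompl_tauPerp {σ : (Fin r → Fqn) →ₗ[Fqn] (Fin r → Fqn) →ₗ[Fqn] Fqn}
    (hσ : ∀ u : Fin r → Fqn, (∀ v : Fin r → Fqn, σ u v = 0) → u = 0)
    (hσ' : ∀ v : Fin r → Fqn, (∀ u : Fin r → Fqn, σ u v = 0) → v = 0)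
    {V₁ V₂ : Submodule Fqn (Fin r → Fqn)} (h : IsCompl V₁ V₂) :
    IsCompl (tauPerp σ V₁) (tauPerp σ V₂) := by
  have hdisj : Disjoint (tauPerp σ V₁) (tauPerp σ V₂) := by
    rw [Submodule.disjoint_def]
    refine fun v hv₁ hv₂ => hσ' v fun u => ?_
    obtain ⟨a, ha, b, hb, rfl⟩ :=
      Submodule.mem_sup.1 (h.sup_eq_top ▸ Submodule.mem_top : u ∈ V₁ ⊔ V₂)
    rw [map_add, LinearMap.add_apply, hv₁ a ha, hv₂ b hb, add_zero]
  have h₁ := finrank_add_finrank_tauPerp hσ V₁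
  have h₂ := finrank_add_finrank_tauPerp hσ V₂
  have h₃ := Submodule.finrank_add_eq_of_isCompl h
  rw [Module.finrank_fin_fun] at h₃
  refine ⟨hdisj, codisjoint_iff.2 (Submodule.eq_top_of_disjoint _ _ ?_ hdisj)⟩
  rw [Module.finrank_fin_fun]
  omega

/-- The dimension of `U^{τ'} ∩ R^τ` in terms of that of `U ∩ R`. -/
theorem finrank_tauPerp'_inf_tauPerp [Fintype Fq] [FiniteDimensional Fq Fqn]
    [Algebra.IsSeparable Fq Fqn] {σ : (Fin r → Fqn) →ₗ[Fqn] (Fin r → Fqn) →ₗ[Fqn] Fqn}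
    (hσ : ∀ u : Fin r → Fqn, (∀ v : Fin r → Fqn, σ u v = 0) → u = 0)
    (U : Submodule Fq (Fin r → Fqn)) (R : Submodule Fqn (Fin r → Fqn)) :
    Module.finrank Fq U + Module.finrank Fq Fqn * Module.finrank Fqn R +
      Module.finrank Fq ↥(tauPerp' (Fq := Fq) σ U ⊓ (tauPerp σ R).restrictScalars Fq) =
    r * Module.finrank Fq Fqn + Module.finrank Fq ↥(U ⊓ R.restrictScalars Fq) := by
  have h := finrank_add_finrank_of_mem_iff_forall_eq_zero (traceBilin Fq σ)
    (traceBilin_injective hσ) (U ⊔ R.restrictScalars Fq)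
    (tauPerp' (Fq := Fq) σ U ⊓ (tauPerp σ R).restrictScalars Fq) fun v => by
      rw [Submodule.mem_inf, Submodule.restrictScalars_mem,
        mem_tauPerp_iff_forall_trace_eq_zero (Fq := Fq)]
      constructor
      · rintro ⟨hU, hR⟩ u hu
        obtain ⟨a, ha, b, hb, rfl⟩ := Submodule.mem_sup.1 hu
        rw [traceBilin_apply, map_add, LinearMap.add_apply, map_add, hU a ha, hR b hb, add_zero]
      · exact fun hv => ⟨fun u hu => hv u (Submodule.mem_sup_left hu),
          fun u hu => hv u (Submodule.mem_sup_right hu)⟩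
  have hsup := Submodule.finrank_sup_add_finrank_inf_eq U (R.restrictScalars Fq)
  have hR : Module.finrank Fq Fqn * Module.finrank Fqn R =
      Module.finrank Fq (R.restrictScalars Fq) := Module.finrank_mul_finrank Fq Fqn R
  have hV := Module.finrank_mul_finrank Fq Fqn (Fin r → Fqn)
  rw [Module.finrank_fin_fun, mul_comm] at hV
  omega

end

/-- The (ordinary) dual of an indecomposable maximum scattered
subspace decomposes dually: if `U ≤ V = F_{q^n}^r` is scattered of `F_q`-dimension
`rn/2` and `V = V₁ ⊕ V₂` with `dim_{F_{q^n}} V₁ = i`, `dim_{F_q}(U ∩ V₁) = in/2`,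
`dim_{F_q}(U ∩ V₂) = (r-i)n/2`, then `V = V₁^τ ⊕ V₂^τ`,
`dim_{F_q}(U^{τ'} ∩ V₁^τ) = (r-i)n/2` and `dim_{F_q}(U^{τ'} ∩ V₂^τ) = in/2`. -/
theorem dual_of_decomposition
    (q n r : ℕ) (hn : 0 < n) (hr : 0 < r) (heven : 2 ∣ r * n)
    (Fq Fqn : Type*) [Field Fq] [Fintype Fq] [Field Fqn] [Algebra Fq Fqn]
    (hq : Fintype.card Fq = q) (hrank : Module.finrank Fq Fqn = n)
    (σ : (Fin r → Fqn) →ₗ[Fqn] (Fin r → Fqn) →ₗ[Fqn] Fqn)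
    (hσ : ∀ u : Fin r → Fqn, (∀ v : Fin r → Fqn, σ u v = 0) → u = 0)
    (hσ' : ∀ v : Fin r → Fqn, (∀ u : Fin r → Fqn, σ u v = 0) → v = 0)
    (U : Submodule Fq (Fin r → Fqn))
    (hUdim : Module.finrank Fq U * 2 = r * n)
    -- `U` is scattered
    (hUscat : ∀ H : Submodule Fqn (Fin r → Fqn), Module.finrank Fqn H = 1 →
      Module.finrank Fq ↥(U ⊓ H.restrictScalars Fq) ≤ 1)
    (i : ℕ) (hi2 : 2 ≤ i) (hir : 2 * i ≤ r)
    (V₁ V₂ : Submodule Fqn (Fin r → Fqn)) (hcompl : IsCompl V₁ V₂)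
    (hV₁ : Module.finrank Fqn V₁ = i)
    (hd₁ : Module.finrank Fq ↥(U ⊓ V₁.restrictScalars Fq) * 2 = i * n)
    (hd₂ : Module.finrank Fq ↥(U ⊓ V₂.restrictScalars Fq) * 2 = (r - i) * n) :
    IsCompl (tauPerp σ V₁) (tauPerp σ V₂) ∧
    Module.finrank Fq
      ↥(tauPerp' (Fq := Fq) σ U ⊓ (tauPerp σ V₁).restrictScalars Fq) * 2 = (r - i) * n ∧
    Module.finrank Fq
      ↥(tauPerp' (Fq := Fq) σ U ⊓ (tauPerp σ V₂).restrictScalars Fq) * 2 = i * n := by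
  have : FiniteDimensional Fq Fqn := Module.finite_of_finrank_pos (hrank ▸ hn)
  have hV₂ : Module.finrank Fqn V₂ = r - i := by
    have h := Submodule.finrank_add_eq_of_isCompl hcompl
    rw [Module.finrank_fin_fun] at h
    omega
  have h₁ := finrank_tauPerp'_inf_tauPerp hσ U V₁
  have h₂ := finrank_tauPerp'_inf_tauPerp hσ U V₂
  rw [hrank, hV₁, mul_comm n i] at h₁
  rw [hrank, hV₂, mul_comm n (r - i)] at h₂
  have hsplit : (r - i) * n + i * n = r * n := by
    rw [← add_mul, Nat.sub_add_cancel (by omega)]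
  exact ⟨isCompl_tauPerp hσ hσ' hcompl, by omega, by omega⟩
end

section
/- Assume gcd(I, J, n) = 1 and that the polynomial P^{I,J}_{α,β,γ}(X) has no roots in F_{q^n}. Then the F_q-subspace U^{I,J,n}_{α,β,γ} of F_{q^n}^4 is scattered; equivalently, if x, y, u, v ∈ F_{q^n} and λ ∈ F_{q^n} \ F_q satisfy (x, y, x^{q^I} + α y^{q^J}, x^{q^J} + β y^{q^I} + γ y^{q^J}) = λ·(u, v, u^{q^I} + α v^{q^J}, u^{q^J} + β v^{q^I} + γ v^{q^J}), then u = v = 0. -/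
open Module

namespace ScatteredSeq

variable (q : ℕ) (Fq : Type*) [Field Fq] [Fintype Fq] {Fqn : Type*} [Field Fqn]
  [Algebra Fq Fqn]

theorem frob_add (hq : Fintype.card Fq = q) (t : ℕ) (a b : Fqn) :
    (a + b) ^ q ^ t = a ^ q ^ t + b ^ q ^ t := by
  obtain ⟨p, hp⟩ := CharP.exists Fq
  haveI : CharP Fqn p := charP_of_injective_algebraMap (algebraMap Fq Fqn).injective p
  obtain ⟨k, hprime, hcard⟩ := FiniteField.card Fq p
  haveI : Fact p.Prime := ⟨hprime⟩
  subst hq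
  rw [hcard, ← pow_mul]
  exact add_pow_char_pow a b p _

theorem frob_algebraMap (hq : Fintype.card Fq = q) (t : ℕ) (c : Fq) :
    (algebraMap Fq Fqn c) ^ q ^ t = algebraMap Fq Fqn c := by
  rw [← map_pow]
  congr 1
  subst hq
  exact FiniteField.pow_card_pow t c

/-- The vector `(x, y, x^{q^I} + α y^{q^J}, x^{q^J} + β y^{q^I} + γ y^{q^J})`. -/
def Uvec (α β γ : Fqn) (I J : ℕ) (x y : Fqn) : Fin 4 → Fqn :=
  ![x, y, x ^ q ^ I + α * y ^ q ^ J, x ^ q ^ J + β * y ^ q ^ I + γ * y ^ q ^ J]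

/-- The `F_q`-subspace `U^{I,J,n}_{α,β,γ}` of `F_{q^n}^4`. -/
def Uspace (hq : Fintype.card Fq = q) (α β γ : Fqn) (I J : ℕ) :
    Submodule Fq (Fin 4 → Fqn) where
  carrier := {w | ∃ x y : Fqn, w = Uvec q α β γ I J x y}
  zero_mem' := by
    have hq0 : q ≠ 0 := by subst hq; exact Fintype.card_ne_zero
    exact ⟨0, 0, by funext i; fin_cases i <;>
      simp [Uvec, zero_pow (pow_ne_zero _ hq0)]⟩
  add_mem' := by
    rintro a b ⟨x₁, y₁, rfl⟩ ⟨x₂, y₂, rfl⟩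
    refine ⟨x₁ + x₂, y₁ + y₂, ?_⟩
    funext i
    fin_cases i <;>
      simp [Uvec, frob_add q Fq hq, mul_add] <;> ring
  smul_mem' := by
    rintro c w ⟨x, y, rfl⟩
    refine ⟨c • x, c • y, ?_⟩
    funext i
    fin_cases i <;>
      simp [Uvec, Algebra.smul_def, mul_pow, frob_algebraMap q Fq hq] <;> ring

/-- An `F_q`-subspace of `F_{q^n}^k` is scattered if it meets every `F_{q^n}`-line in
an `F_q`-subspace of dimension at most `1`. -/
def IsScattered {k : ℕ} (U : Submodule Fq (Fin k → Fqn)) : Prop :=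
  ∀ H : Submodule Fqn (Fin k → Fqn), finrank Fqn H = 1 →
    finrank Fq ↥(U ⊓ H.restrictScalars Fq) ≤ 1

/-- The polynomial `P^{I,J}_{α,β,γ}` has no roots in `F_{q^n}`. -/
def PHasNoRoot (α β γ : Fqn) (I J : ℕ) : Prop :=
  if I < J then ∀ x : Fqn, x ^ (q ^ (J - I) + 1) + γ * x - α * β ≠ 0
  else ∀ x : Fqn, x ^ (q ^ (I - J) + 1) + γ * x ^ q ^ (I - J) - α * β ≠ 0

end ScatteredSeq

open ScatteredSeq Module

namespace ScatteredSeq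

/-- An element of an extension of a finite field `Fq` of order `q` that is fixed by `x ↦ x ^ q`
lies in `Fq`. -/
theorem mem_range_algebraMap_of_pow_eq_self {Fq Fqn : Type*} [Field Fq] [Fintype Fq] [Field Fqn]
    [Algebra Fq Fqn] {a : Fqn} (h : a ^ Fintype.card Fq = a) :
    a ∈ Set.range (algebraMap Fq Fqn) := by
  have hsplits : (Polynomial.X ^ Fintype.card Fq - Polynomial.X : Polynomial Fq).Splits := by
    rw [Polynomial.splits_iff_card_roots, FiniteField.roots_X_pow_card_sub_X,
      FiniteField.X_pow_card_sub_X_natDegree_eq Fq Fintype.one_lt_card, ← Finset.card_def,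
      Finset.card_univ]
  exact hsplits.mem_range_of_isRoot
    (FiniteField.X_pow_card_sub_X_ne_zero Fq Fintype.one_lt_card) (by simp [h])

/-- An element fixed by the Frobenius powers of exponents `I`, `J` and by the one of exponent
the degree of the extension lies in the base field when these exponents are coprime. -/
theorem mem_range_algebraMap_of_frob_fixed {Fq Fqn : Type*} [Field Fq] [Fintype Fq] [Field Fqn]
    [Algebra Fq Fqn] [FiniteDimensional Fq Fqn] {I J : ℕ}
    (hgcd : Nat.gcd (Nat.gcd I J) (finrank Fq Fqn) = 1) {a : Fqn}
    (hI : a ^ Fintype.card Fq ^ I = a) (hJ : a ^ Fintype.card Fq ^ J = a) :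
    a ∈ Set.range (algebraMap Fq Fqn) := by
  have periodic {t : ℕ} (ht : a ^ Fintype.card Fq ^ t = a) :
      Function.IsPeriodicPt (· ^ Fintype.card Fq) t a := by
    rw [Function.IsPeriodicPt, Function.IsFixedPt, pow_iterate]
    exact ht
  have hn : a ^ Fintype.card Fq ^ finrank Fq Fqn = a := by
    have : Finite Fqn := Module.finite_of_finite Fq
    have := Fintype.ofFinite Fqn
    rw [← Module.card_eq_pow_finrank, FiniteField.pow_card]
  have h := ((periodic hI).gcd (periodic hJ)).gcd (periodic hn)
  rw [hgcd] at h
  exact mem_range_algebraMap_of_pow_eq_self (by simpa using h.isFixedPt.eq)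

variable {q : ℕ} {F : Type*} [Field F] {α β γ : F} {I J : ℕ}

theorem PHasNoRoot.ne_zero (hP : PHasNoRoot q α β γ I J) (hIJ : I ≠ J) (z : F) :
    z ^ q ^ I * z ^ q ^ J + γ * z ^ q ^ I - α * β ≠ 0 := by
  unfold PHasNoRoot at hP
  split_ifs at hP with h
  · obtain ⟨d, rfl⟩ := Nat.exists_eq_add_of_le h.le
    have := hP (z ^ q ^ I)
    rw [Nat.add_sub_cancel_left, pow_succ, ← pow_mul, ← pow_add q] at this
    rwa [mul_comm (z ^ q ^ I) (z ^ _)]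
  · obtain ⟨d, rfl⟩ := Nat.exists_eq_add_of_le (not_lt.mp h)
    have := hP (z ^ q ^ J)
    rwa [Nat.add_sub_cancel_left, pow_succ, ← pow_mul, ← pow_add q] at this

/-- The system expressing proportionality of two vectors of `U` has only the trivial solution. -/
theorem PHasNoRoot.eq_zero_of_system (hP : PHasNoRoot q α β γ I J) (hIJ : I ≠ J) (hq : q ≠ 0)
    (hα : α ≠ 0) (hβ : β ≠ 0) {A B u v : F} (hAB : ¬(A = 0 ∧ B = 0))
    (h₁ : A * u ^ q ^ I + α * (B * v ^ q ^ J) = 0)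
    (h₂ : B * u ^ q ^ J + β * (A * v ^ q ^ I) + γ * (B * v ^ q ^ J) = 0) :
    u = 0 ∧ v = 0 := by
  have hqt (t : ℕ) : q ^ t ≠ 0 := pow_ne_zero t hq
  by_cases hA : A = 0
  · have hB : B ≠ 0 := fun hB => hAB ⟨hA, hB⟩
    simp_all
  by_cases hB : B = 0
  · simp_all
  by_cases hv : v = 0
  · simp_all
  exfalso
  apply hP.ne_zero hIJ (u / v)
  have hvI := pow_ne_zero (q ^ I) hv
  have hvJ := pow_ne_zero (q ^ J) hv
  rw [div_pow, div_pow]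
  field_simp
  apply mul_left_cancel₀ hB
  linear_combination u ^ q ^ I * h₂ - β * v ^ q ^ I * h₁

theorem mem_range_algebraMap_of_Uvec_eq_smul {q : ℕ} {Fq Fqn : Type*} [Field Fq] [Fintype Fq]
    [Field Fqn] [Algebra Fq Fqn] [FiniteDimensional Fq Fqn] (hq : Fintype.card Fq = q)
    {α β γ : Fqn} {I J : ℕ} (hα : α ≠ 0) (hβ : β ≠ 0) (hIJ : I ≠ J)
    (hgcd : Nat.gcd (Nat.gcd I J) (finrank Fq Fqn) = 1) (hP : PHasNoRoot q α β γ I J)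
    {a x y u v : Fqn} (h : Uvec q α β γ I J x y = a • Uvec q α β γ I J u v)
    (hne : Uvec q α β γ I J u v ≠ 0) :
    a ∈ Set.range (algebraMap Fq Fqn) := by
  have hq0 : q ≠ 0 := hq ▸ Fintype.card_ne_zero
  by_contra ha
  have hAB : ¬(a ^ q ^ I - a = 0 ∧ a ^ q ^ J - a = 0) := by
    subst hq
    exact fun ⟨hA, hB⟩ =>
      ha (mem_range_algebraMap_of_frob_fixed hgcd (sub_eq_zero.mp hA) (sub_eq_zero.mp hB))
  have hx : x = a * u := by simpa [Uvec] using congrFun h 0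
  have hy : y = a * v := by simpa [Uvec] using congrFun h 1
  have h₁ := congrFun h 2
  have h₂ := congrFun h 3
  simp only [Uvec, hx, hy, mul_pow, Pi.smul_apply, smul_eq_mul, Matrix.cons_val] at h₁ h₂
  obtain ⟨rfl, rfl⟩ := hP.eq_zero_of_system hIJ hq0 hα hβ hAB
    (u := u) (v := v) (by linear_combination h₁) (by linear_combination h₂)
  refine hne (funext fun i => ?_)
  fin_cases i <;> simp [Uvec, hq0]

end ScatteredSeq

/-- If gcd(I,J,n) = 1 and the polynomial P^{I,J}_{α,β,γ}(X) has no
roots in F_{q^n}, then the F_q-subspace U^{I,J,n}_{α,β,γ} of F_{q^n}^4 is scattered. -/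
theorem Uspace_isScattered
    (q n : ℕ) (Fq Fqn : Type*) [Field Fq] [Fintype Fq] [Field Fqn] [Algebra Fq Fqn]
    (hq : Fintype.card Fq = q) (hrank : Module.finrank Fq Fqn = n)
    (α β γ : Fqn) (hα : α ≠ 0) (hβ : β ≠ 0) (hγ : γ ≠ 0)
    (I J : ℕ) (hI : 0 < I) (hJ : 0 < J) (hIJ : I ≠ J) (hIn : I < n - 1) (hJn : J < n - 1)
    (hgcd : Nat.gcd (Nat.gcd I J) n = 1)
    (hP : PHasNoRoot q α β γ I J) :
    IsScattered Fq (Uspace q Fq hq α β γ I J) := by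
  have : FiniteDimensional Fq Fqn := FiniteDimensional.of_finrank_pos (by omega)
  subst hrank
  intro H hH
  by_cases hbot : Uspace q Fq hq α β γ I J ⊓ H.restrictScalars Fq = ⊥
  · rw [hbot, finrank_bot]
    exact zero_le_one
  obtain ⟨w, ⟨⟨u, v, rfl⟩, hwH⟩, hw⟩ := Submodule.exists_mem_ne_zero_of_ne_bot hbot
  refine finrank_le_one ⟨_, ⟨u, v, rfl⟩, hwH⟩ ?_
  rintro ⟨_, ⟨x, y, rfl⟩, hxH⟩
  obtain ⟨a, ha⟩ := (finrank_eq_one_iff_of_nonzero' (⟨_, hwH⟩ : H)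
    (fun h => hw (congrArg Subtype.val h))).mp hH ⟨_, hxH⟩
  have ha' := congrArg Subtype.val ha
  obtain ⟨c, rfl⟩ := mem_range_algebraMap_of_Uvec_eq_smul hq hα hβ hIJ hgcd hP ha'.symm hw
  exact ⟨c, Subtype.ext (by simpa using ha')⟩
end

section
/- Assume gcd(I, J, n) = 1 and that the polynomial P^{I,J}_{α,β,γ}(X) has no roots in F_{q^n}. Then there exist infinitely many positive integers t such that the F_q-subspace {(x, y, x^{q^I} + α·y^{q^J}, x^{q^J} + β·y^{q^I} + γ·y^{q^J}) : x, y ∈ F_{q^{nt}}} of F_{q^{nt}}^4 is scattered, where F_{q^{nt}} denotes the degree-t extension field of F_{q^n} inside a fixed algebraic closure (so α, β, γ ∈ F_{q^n} ⊆ F_{q^{nt}}). In other words, U^{I,J,n}_{α,β,γ} is exceptional scattered. -/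
open Module

open ScatteredSeq Module

namespace ScatteredSeq

open Polynomial in
/-- A polynomial without roots acquires none in an extension of prime degree exceeding its own. -/
theorem aeval_ne_zero_of_prime_finrank {K L : Type*} [Field K] [Field L] [Algebra K L]
    {f : K[X]} (hf0 : f ≠ 0) (hf : ∀ x : K, f.eval x ≠ 0)
    (hprime : (finrank K L).Prime) (hdeg : f.natDegree < finrank K L) (x : L) :
    aeval x f ≠ 0 := by
  intro hx
  have : FiniteDimensional K L := FiniteDimensional.of_finrank_pos hprime.pos
  have hint : IsIntegral K x := Algebra.IsIntegral.isIntegral x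
  have hle : (minpoly K x).natDegree ≤ f.natDegree :=
    natDegree_le_of_dvd (minpoly.dvd K x hx) hf0
  have hone : (minpoly K x).natDegree = 1 :=
    (hprime.eq_one_or_self_of_dvd _ (minpoly.degree_dvd hint)).resolve_right (by omega)
  obtain ⟨y, rfl⟩ := (minpoly.natDegree_eq_one_iff).mp hone
  rw [aeval_algebraMap_apply, coe_aeval_eq_eval] at hx
  exact hf y ((map_eq_zero _).mp hx)

open Polynomial in
theorem mem_range_algebraMap_of_pow_card_eq_self {F L : Type*} [Field F] [Fintype F] [Field L]
    [Algebra F L] {x : L} (hx : x ^ Fintype.card F = x) : ∃ c : F, algebraMap F L c = x := by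
  have hprod : (X ^ Fintype.card F - X : F[X]) = ∏ c : F, (X - C c) := by
    have hdeg := FiniteField.X_pow_card_sub_X_natDegree_eq F (Fintype.one_lt_card (α := F))
    have h := prod_multiset_X_sub_C_of_monic_of_roots_card_eq
      (p := (X ^ Fintype.card F - X : F[X]))
      (monic_X_pow_sub (by rw [degree_X]; exact_mod_cast Fintype.one_lt_card))
      (by rw [FiniteField.roots_X_pow_card_sub_X, hdeg]; simp)
    rw [FiniteField.roots_X_pow_card_sub_X] at h
    exact h.symm
  have h := congrArg (aeval x) hprod
  simp only [map_sub, map_pow, aeval_X, hx, sub_self, map_prod, aeval_C] at h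
  obtain ⟨c, -, hc⟩ := Finset.prod_eq_zero_iff.mp h.symm
  exact ⟨c, (sub_eq_zero.mp hc).symm⟩

/-- An element of a finite field extension fixed by coprime powers of Frobenius is a scalar. -/
theorem mem_range_algebraMap_of_pow_eq_self_s7 {F L : Type*} [Field F] [Fintype F] [Field L]
    [Algebra F L] [FiniteDimensional F L] {I J : ℕ}
    (hgcd : Nat.gcd (Nat.gcd I J) (finrank F L) = 1) {x : L}
    (hI : x ^ Fintype.card F ^ I = x) (hJ : x ^ Fintype.card F ^ J = x) :
    ∃ c : F, algebraMap F L c = x := by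
  have hper : ∀ m, x ^ Fintype.card F ^ m = x →
      Function.IsPeriodicPt (fun y : L => y ^ Fintype.card F) m x := by
    intro m hm
    rw [Function.IsPeriodicPt, Function.IsFixedPt, pow_iterate]
    exact hm
  have hL : x ^ Fintype.card F ^ finrank F L = x := by
    have : Finite L := Module.finite_of_finite F
    have : Fintype L := Fintype.ofFinite L
    rw [← Module.card_eq_pow_finrank]
    exact FiniteField.pow_card x
  have h := ((hper I hI).gcd (hper J hJ)).gcd (hper _ hL)
  rw [hgcd] at h
  exact mem_range_algebraMap_of_pow_card_eq_self h

/-- A multiple of a nonzero `Uvec` is again a `Uvec` only if the scalar is fixed by both Frobenius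
powers, provided the associated trinomial has no roots. -/
theorem pow_eq_self_of_smul_Uvec_eq {L : Type*} [Field L] {q I J : ℕ} (hq : q ≠ 0)
    {α β γ l x y x' y' : L}
    (hβ : β ≠ 0)
    (hroot : ∀ z : L, z ^ q ^ J * z ^ q ^ I + γ * z ^ q ^ I - α * β ≠ 0)
    (hne : Uvec q α β γ I J x y ≠ 0)
    (h : l • Uvec q α β γ I J x y = Uvec q α β γ I J x' y') :
    l ^ q ^ I = l ∧ l ^ q ^ J = l := by
  have h0 := congrFun h 0
  have h1 := congrFun h 1
  have h2 := congrFun h 2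
  have h3 := congrFun h 3
  simp only [Uvec, Pi.smul_apply, smul_eq_mul, Matrix.cons_val] at h0 h1 h2 h3
  subst h0 h1
  simp only [mul_pow] at h2 h3
  have hqI : q ^ I ≠ 0 := pow_ne_zero _ hq
  have hqJ : q ^ J ≠ 0 := pow_ne_zero _ hq
  have hxy : ¬ (x = 0 ∧ y = 0) := by
    rintro ⟨rfl, rfl⟩
    apply hne
    funext i
    fin_cases i <;> simp [Uvec, zero_pow hqI, zero_pow hqJ]
  have e2 : (l ^ q ^ I - l) * x ^ q ^ I + α * (l ^ q ^ J - l) * y ^ q ^ J = 0 := by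
    linear_combination -h2
  have e3 : (l ^ q ^ J - l) * x ^ q ^ J + β * (l ^ q ^ I - l) * y ^ q ^ I
      + γ * (l ^ q ^ J - l) * y ^ q ^ J = 0 := by
    linear_combination -h3
  rw [← sub_eq_zero, ← sub_eq_zero (a := l ^ q ^ J)]
  generalize l ^ q ^ I - l = A at *
  generalize l ^ q ^ J - l = B at *
  by_cases hy : y = 0
  · have hx : x ≠ 0 := fun hx => hxy ⟨hx, hy⟩
    simpa [hy, zero_pow hqI, zero_pow hqJ, hx] using And.intro e2 e3
  by_cases hB : B = 0
  · simpa [hB, hy, hβ] using e3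
  exfalso
  apply hroot (x / y)
  have hyI : y ^ q ^ I ≠ 0 := pow_ne_zero _ hy
  have hyJ : y ^ q ^ J ≠ 0 := pow_ne_zero _ hy
  rw [div_pow, div_pow]
  field_simp
  apply mul_left_cancel₀ hB
  linear_combination x ^ q ^ I * e3 - β * y ^ q ^ I * e2

open Polynomial in
/-- The polynomial `P^{I,J}_{α,β,γ}`. -/
noncomputable def Ppoly {K : Type*} [Field K] (q : ℕ) (α β γ : K) (I J : ℕ) : K[X] :=
  if I < J then X ^ (q ^ (J - I) + 1) + C γ * X - C (α * β)
  else X ^ (q ^ (I - J) + 1) + C γ * X ^ q ^ (I - J) - C (α * β)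

theorem PHasNoRoot_iff_eval_Ppoly {K : Type*} [Field K] {q : ℕ} {α β γ : K} {I J : ℕ} :
    PHasNoRoot q α β γ I J ↔ ∀ x, (Ppoly q α β γ I J).eval x ≠ 0 := by
  unfold PHasNoRoot Ppoly
  split_ifs <;> simp

theorem PHasNoRoot.algebraMap {K L : Type*} [Field K] [Field L] [Algebra K L]
    {q : ℕ} {α β γ : K} {I J : ℕ} (h : PHasNoRoot q α β γ I J)
    (hprime : (finrank K L).Prime) (hdeg : (Ppoly q α β γ I J).natDegree < finrank K L) :
    PHasNoRoot q (algebraMap K L α) (algebraMap K L β) (algebraMap K L γ) I J := by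
  rw [PHasNoRoot_iff_eval_Ppoly] at h ⊢
  have h0 : Ppoly q α β γ I J ≠ 0 := fun h0 => h 0 (by rw [h0, Polynomial.eval_zero])
  intro x
  have hx := aeval_ne_zero_of_prime_finrank h0 h hprime hdeg x
  contrapose! hx
  rw [← hx]
  unfold Ppoly
  split_ifs <;> simp

theorem PHasNoRoot.mul_pow_add_ne_zero {L : Type*} [Field L] {q : ℕ} {α β γ : L} {I J : ℕ}
    (h : PHasNoRoot q α β γ I J) (z : L) :
    z ^ q ^ J * z ^ q ^ I + γ * z ^ q ^ I - α * β ≠ 0 := by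
  unfold PHasNoRoot at h
  split_ifs at h with hIJ
  · convert h (z ^ q ^ I) using 3
    rw [pow_succ, ← pow_mul, ← pow_add q, Nat.add_sub_cancel' hIJ.le]
  · have hpow : (z ^ q ^ J) ^ q ^ (I - J) = z ^ q ^ I := by
      rw [← pow_mul, ← pow_add, Nat.add_sub_cancel' (not_lt.mp hIJ)]
    convert h (z ^ q ^ J) using 3
    · rw [pow_succ, hpow, mul_comm]
    · rw [hpow]

/-- If `P^{I,J}_{α,β,γ}` has no roots and `I`, `J` and the degree are coprime, then
`U^{I,J,n}_{α,β,γ}` is scattered. -/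
theorem isScattered_Uspace {q : ℕ} {F L : Type*} [Field F] [Fintype F] [Field L] [Algebra F L]
    [FiniteDimensional F L] (hq : Fintype.card F = q) {α β γ : L} {I J : ℕ}
    (hβ : β ≠ 0) (hgcd : Nat.gcd (Nat.gcd I J) (finrank F L) = 1)
    (hP : PHasNoRoot q α β γ I J) : IsScattered F (Uspace q F hq α β γ I J) := by
  intro H hH
  have hq0 : q ≠ 0 := hq ▸ Fintype.card_ne_zero
  by_cases hbot : ∀ w : ↥(Uspace q F hq α β γ I J ⊓ H.restrictScalars F), w = 0
  · exact finrank_le_one 0 fun w => ⟨0, by rw [hbot w, smul_zero]⟩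
  push Not at hbot
  obtain ⟨⟨u, ⟨x, y, rfl⟩, huH⟩, hu⟩ := hbot
  have hu0 : Uvec q α β γ I J x y ≠ 0 := fun h => hu (Subtype.ext h)
  refine finrank_le_one ⟨_, ⟨x, y, rfl⟩, huH⟩ ?_
  rintro ⟨w, ⟨x', y', rfl⟩, hwH⟩
  obtain ⟨l, hl⟩ := exists_smul_eq_of_finrank_eq_one hH
    (x := (⟨_, huH⟩ : H)) (fun h => hu0 (congrArg Subtype.val h)) ⟨_, hwH⟩
  have hl' := congrArg Subtype.val hl
  obtain ⟨h1, h2⟩ := pow_eq_self_of_smul_Uvec_eq hq0 hβ hP.mul_pow_add_ne_zero hu0 hl'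
  subst hq
  obtain ⟨c, rfl⟩ := mem_range_algebraMap_of_pow_eq_self_s7 hgcd h1 h2
  refine ⟨c, Subtype.ext ?_⟩
  rw [← hl']
  exact (algebraMap_smul L c _).symm

end ScatteredSeq

/-- If gcd(I,J,n) = 1 and P^{I,J}_{α,β,γ}(X) has no roots in F_{q^n},
then for infinitely many positive integers t, the subspace
{(x, y, x^{q^I} + αy^{q^J}, x^{q^J} + βy^{q^I} + γy^{q^J}) : x, y ∈ F_{q^{nt}}}
of F_{q^{nt}}^4 is a scattered F_q-subspace; i.e. U^{I,J,n}_{α,β,γ} is exceptional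
scattered.  A degree-t extension of F_{q^n} is formalized as any field L with
Algebra F_{q^n} L and dim_{F_{q^n}} L = t (compatibly an F_q-algebra). -/
theorem Uspace_exceptional_scattered
    (q n : ℕ) (Fq Fqn : Type*) [Field Fq] [Fintype Fq] [Field Fqn] [Algebra Fq Fqn]
    (hq : Fintype.card Fq = q) (hrank : Module.finrank Fq Fqn = n)
    (α β γ : Fqn) (hα : α ≠ 0) (hβ : β ≠ 0) (hγ : γ ≠ 0)
    (I J : ℕ) (hI : 0 < I) (hJ : 0 < J) (hIJ : I ≠ J) (hIn : I < n - 1) (hJn : J < n - 1)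
    (hgcd : Nat.gcd (Nat.gcd I J) n = 1)
    (hP : PHasNoRoot q α β γ I J) :
    {t : ℕ | 0 < t ∧
      ∀ (L : Type*) [Field L] [Algebra Fq L] [Algebra Fqn L] [IsScalarTower Fq Fqn L],
        Module.finrank Fqn L = t →
          IsScattered Fq (Uspace q Fq hq (algebraMap Fqn L α) (algebraMap Fqn L β)
            (algebraMap Fqn L γ) I J)}.Infinite := by
  have hn : 0 < n := by omega
  have hfin : FiniteDimensional Fq Fqn := FiniteDimensional.of_finrank_pos (hrank ▸ hn)
  refine Set.infinite_of_not_bddAbove ?_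
  rintro ⟨b, hb⟩
  obtain ⟨t, ht, htp⟩ :=
    Nat.exists_infinite_primes (b + (Ppoly q α β γ I J).natDegree + I + 1)
  suffices hmem : t ≤ b by omega
  refine hb ⟨htp.pos, ?_⟩
  intro L _ _ _ _ hL
  have : FiniteDimensional Fqn L := FiniteDimensional.of_finrank_pos (hL ▸ htp.pos)
  have : FiniteDimensional Fq L := FiniteDimensional.trans Fq Fqn L
  refine isScattered_Uspace hq (by simpa using hβ) ?_
    (hP.algebraMap (hL ▸ htp) (by omega))
  rw [← finrank_mul_finrank Fq Fqn L, hrank, hL]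
  refine Nat.Coprime.mul_right hgcd (Nat.Coprime.symm ((htp.coprime_iff_not_dvd).mpr ?_))
  intro hdvd
  have := Nat.le_of_dvd hI (hdvd.trans (Nat.gcd_dvd_left I J))
  omega
end

section
/- Let q be a prime power and let n, K be positive integers with gcd(K, n) = 1 and n not divisible by q + 1. Let γ, c be nonzero elements of F_q such that the polynomial X² + γX − c ∈ F_q[X] is irreducible over F_q and its roots in F_{q²} have multiplicative order q² − 1 (i.e., X² + γX − c is a primitive polynomial over F_q). Then the polynomial X^{q^K + 1} + γX − c has no roots in F_{q^n}. -/
open Polynomial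

/-- An irreducible polynomial over a finite field has a root in every extension of degree equal to
its degree. -/
lemma exists_aeval_eq_zero_of_natDegree_eq_finrank {F L : Type*} [Field F] [Finite F] [Field L]
    [Algebra F L] {f : F[X]} (hf : Irreducible f) (h : f.natDegree = Module.finrank F L) :
    ∃ ρ : L, aeval ρ f = 0 := by
  have hpos : 0 < Module.finrank F L := h ▸ hf.natDegree_pos
  have : Module.Finite F L := Module.finite_of_finrank_pos hpos
  have : Finite L := Module.finite_of_finite F
  have : Fact (Irreducible f) := ⟨hf⟩
  have : Module.Finite F (AdjoinRoot f) := (AdjoinRoot.powerBasis hf.ne_zero).finite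
  have : Finite (AdjoinRoot f) := Module.finite_of_finite F
  have hdvd : Module.finrank F (AdjoinRoot f) ∣ Module.finrank F L := by
    rw [(AdjoinRoot.powerBasis hf.ne_zero).finrank, AdjoinRoot.powerBasis_dim, h]
  obtain ⟨φ⟩ := FiniteField.nonempty_algHom_of_finrank_dvd hdvd
  refine ⟨φ (AdjoinRoot.root f), ?_⟩
  rw [aeval_algHom_apply, AdjoinRoot.aeval_eq, AdjoinRoot.mk_self, map_zero]

/-- In a finite extension of a finite field with `q` elements, the solutions of `x ^ q = x` lie in
the base field. -/
lemma mem_range_algebraMap_of_pow_card_eq_self {F L : Type*} [Field F] [Fintype F] [Field L]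
    [Finite L] [Algebra F L] {x : L} (hx : x ^ Fintype.card F = x) :
    x ∈ Set.range (algebraMap F L) := by
  rw [IsGalois.mem_range_algebraMap_iff_fixed]
  intro g
  obtain ⟨p, _⟩ := CharP.exists F
  have : Fact p.Prime := ⟨CharP.char_is_prime F p⟩
  obtain ⟨i, hi⟩ := FiniteField.exists_forall_apply_eq_pow F p L g
  rw [hi, Nat.card_eq_fintype_card]
  simpa only [pow_iterate, Function.IsFixedPt] using
    Function.IsFixedPt.iterate (f := (· ^ Fintype.card F)) hx i

/-- If `x ^ q ^ K = x` and `x ^ q ^ n = x`, then `x ^ q ^ gcd K n = x`. -/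
lemma pow_pow_gcd_eq_self {M : Type*} [Monoid M] {x : M} {q K n : ℕ} (hK : x ^ q ^ K = x)
    (hn : x ^ q ^ n = x) : x ^ q ^ Nat.gcd K n = x := by
  have key (m : ℕ) : Function.IsPeriodicPt (fun y : M ↦ y ^ q) m x ↔ x ^ q ^ m = x := by
    rw [Function.IsPeriodicPt, pow_iterate, Function.IsFixedPt]
  exact (key _).1 (((key K).2 hK).gcd ((key n).2 hn))

/-- If `ρ ^ 2 = c - γ ρ` and `z` satisfies the linear recurrence with the same coefficients, then
`z m` and `z (m + 1)` reduce to initial terms of `z` in the way `ρ ^ m` reduces to `1` and `ρ`. -/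
lemma exists_pow_eq_and_recurrence_eq {F L E : Type*} [CommRing F] [CommRing L] [CommRing E]
    [Algebra F L] [Algebra F E] {γ c : F} {ρ : L}
    (hρ : ρ ^ 2 = algebraMap F L c - algebraMap F L γ * ρ) {z : ℕ → E} (hz₀ : z 0 = 1)
    (hz : ∀ k, z (k + 2) = algebraMap F E c * z k - algebraMap F E γ * z (k + 1)) (m : ℕ) :
    ∃ a b : F, ρ ^ m = algebraMap F L a * ρ + algebraMap F L b ∧
      z m = algebraMap F E a * z 1 + algebraMap F E b ∧
      z (m + 1) = algebraMap F E a * z 2 + algebraMap F E b * z 1 := by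
  induction m with
  | zero => exact ⟨0, 1, by simp [hz₀]⟩
  | succ m ih =>
    obtain ⟨a, b, h₁, h₂, h₃⟩ := ih
    have hz₂ := hz 0
    rw [hz₀, zero_add, zero_add] at hz₂
    refine ⟨b - a * γ, a * c, ?_, ?_, ?_⟩
    · rw [pow_succ, h₁]
      simp only [map_sub, map_mul]
      linear_combination algebraMap F L a * hρ
    · rw [h₃]
      simp only [map_sub, map_mul]
      linear_combination algebraMap F E a * hz₂
    · rw [hz m, h₂, h₃]
      simp only [map_sub, map_mul]
      linear_combination -algebraMap F E b * hz₂

/-- If `ρ` has order `q ^ 2 - 1` and `ρ ^ n` lies in the base field with `q` elements, then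
`q + 1` divides `n`. -/
lemma add_one_dvd_of_pow_eq_algebraMap {F L : Type*} [Field F] [Fintype F] [Field L] [Algebra F L]
    {ρ : L} (hρ : orderOf ρ = Fintype.card F ^ 2 - 1) {n : ℕ} {b : F}
    (h : ρ ^ n = algebraMap F L b) : Fintype.card F + 1 ∣ n := by
  have hq : 1 < Fintype.card F := Fintype.one_lt_card
  have hρ₀ : ρ ≠ 0 := by
    rintro rfl
    rw [orderOf_zero] at hρ
    have : 2 ^ 2 ≤ Fintype.card F ^ 2 := Nat.pow_le_pow_left hq 2
    omega
  have hb : b ≠ 0 := by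
    rintro rfl
    exact pow_ne_zero n hρ₀ (by simpa using h)
  have hone : ρ ^ (n * (Fintype.card F - 1)) = 1 := by
    rw [pow_mul, h, ← map_pow, FiniteField.pow_card_sub_one_eq_one b hb, map_one]
  have hdvd := orderOf_dvd_of_pow_eq_one hone
  rw [hρ, ← one_pow 2, Nat.sq_sub_sq] at hdvd
  exact Nat.dvd_of_mul_dvd_mul_right (by omega) hdvd

/-- Let gcd(K, n) = 1 and (q+1) ∤ n.  If γ, c ∈ F_q* are such that
X² + γX − c is a primitive irreducible quadratic over F_q (its roots in F_{q²} have
multiplicative order q² − 1), then X^{q^K + 1} + γX − c has no roots in F_{q^n}. -/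
theorem no_roots_of_primitive_quadratic
    (q n K : ℕ) (hn : 0 < n) (hK : 0 < K)
    (hgcd : Nat.gcd K n = 1) (hndvd : ¬ (q + 1) ∣ n)
    (Fq Fq2 Fqn : Type*) [Field Fq] [Fintype Fq]
    [Field Fq2] [Algebra Fq Fq2] [Field Fqn] [Algebra Fq Fqn]
    (hq : Fintype.card Fq = q)
    (h2 : Module.finrank Fq Fq2 = 2)
    (hrank : Module.finrank Fq Fqn = n)
    (γ c : Fq) (hγ : γ ≠ 0) (hc : c ≠ 0)
    (hirr : Irreducible (X ^ 2 + C γ * X - C c))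
    (hprim : ∀ ρ : Fq2,
      ρ ^ 2 + algebraMap Fq Fq2 γ * ρ - algebraMap Fq Fq2 c = 0 →
        orderOf ρ = q ^ 2 - 1) :
    ∀ x : Fqn,
      x ^ (q ^ K + 1) + algebraMap Fq Fqn γ * x - algebraMap Fq Fqn c ≠ 0 := by
  intro x hx
  subst hq
  have : Module.Finite Fq Fqn := Module.finite_of_finrank_pos (hrank ▸ hn)
  have : Finite Fqn := Module.finite_of_finite Fq
  have hdeg : (X ^ 2 + C γ * X - C c).natDegree = 2 := by compute_degree!
  obtain ⟨ρ, hρ⟩ := exists_aeval_eq_zero_of_natDegree_eq_finrank (L := Fq2) hirr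
    (hdeg.trans h2.symm)
  replace hρ : ρ ^ 2 + algebraMap Fq Fq2 γ * ρ - algebraMap Fq Fq2 c = 0 := by simpa using hρ
  have hx₀ : x ≠ 0 := by
    rintro rfl
    simp [hc] at hx
  generalize hQ : Fintype.card Fq ^ K = Q at hx
  have hpow (k : ℕ) : x ^ Q ^ k * x ^ Q ^ (k + 1) =
      algebraMap Fq Fqn c - algebraMap Fq Fqn γ * x ^ Q ^ k := by
    have hφ (y : Fqn) : (FiniteField.frobeniusAlgHom Fq Fqn ^ (K * k)) y = y ^ Q ^ k := by
      rw [AlgHom.coe_pow, FiniteField.coe_frobeniusAlgHom, pow_iterate, pow_mul, hQ]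
    have h := congrArg (FiniteField.frobeniusAlgHom Fq Fqn ^ (K * k)) hx
    rw [map_sub, map_add, map_mul, map_pow, AlgHom.commutes, AlgHom.commutes, map_zero, hφ] at h
    linear_combination h
  set z : ℕ → Fqn := fun k ↦ ∏ i ∈ Finset.range k, x ^ Q ^ i with hz
  have hz₁ : z 1 = x := by simp [hz]
  have hz₂ : z 2 = x * x ^ Q := by simp [hz, Finset.prod_range_succ]
  have hsucc (k : ℕ) : z (k + 1) = z k * x ^ Q ^ k := Finset.prod_range_succ _ _
  obtain ⟨a, b, hρn, hzn, hzn'⟩ := exists_pow_eq_and_recurrence_eq (E := Fqn)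
    (show ρ ^ 2 = algebraMap Fq Fq2 c - algebraMap Fq Fq2 γ * ρ by linear_combination hρ)
    (z := z) (by simp [hz])
    (fun k ↦ by rw [hsucc (k + 1), hsucc k]; linear_combination z k * hpow k) n
  have ha : a ≠ 0 := by
    rintro rfl
    exact hndvd (add_one_dvd_of_pow_eq_algebraMap (hprim ρ hρ) (by simpa using hρn))
  have hxn : x ^ Fintype.card Fq ^ n = x := by
    have := Fintype.ofFinite Fqn
    rw [← hrank, ← Module.card_eq_pow_finrank, FiniteField.pow_card]
  have hxQn : x ^ Q ^ n = x := by
    rw [← hQ, ← pow_mul, mul_comm, pow_mul]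
    simpa only [pow_iterate, Function.IsFixedPt] using
      Function.IsFixedPt.iterate (f := (· ^ Fintype.card Fq ^ n)) hxn K
  have hxQ : x ^ Q = x := by
    rw [hsucc, hzn, hxQn, hz₁, hz₂] at hzn'
    have ha' : algebraMap Fq Fqn a ≠ 0 := by simpa using ha
    refine (mul_left_cancel₀ (mul_ne_zero ha' hx₀) ?_).symm
    linear_combination hzn'
  have hxq : x ^ Fintype.card Fq = x := by
    have h := pow_pow_gcd_eq_self (hQ ▸ hxQ) hxn
    rwa [hgcd, pow_one] at h
  obtain ⟨y, rfl⟩ := mem_range_algebraMap_of_pow_card_eq_self hxq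
  have hroot : IsRoot (X ^ 2 + C γ * X - C c) y := by
    rw [pow_succ, hxQ] at hx
    apply (algebraMap Fq Fqn).injective
    simp only [eval_sub, eval_add, eval_mul, eval_pow, eval_X, eval_C, map_sub, map_add, map_mul,
      map_pow, map_zero]
    linear_combination hx
  exact absurd (hdeg.symm.trans (natDegree_eq_of_degree_eq_some
    (degree_eq_one_of_irreducible_of_root hirr hroot))) (by norm_num)
end

section
/- Assume gcd(I, J, n) = 1 and max{I, J} ≤ n/4. If the F_q-subspace U^{I,J,n}_{α,β,γ} of F_{q^n}^4 is scattered, then the polynomial P^{I,J}_{α,β,γ}(X) has no roots in F_{q^n}. -/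
open Module

open ScatteredSeq Module

section Stepanov

open Polynomial

theorem eq_zero_of_sum_X_sub_C_pow_mul_eq_zero {L ι : Type*} [Field L] [Fintype ι] (β : L)
    (m : ι → ℕ) (hm : Function.Injective m) (G : ι → L[X]) (hG : ∀ i, (G i).eval β ≠ 0)
    (a : ι → L) (h : ∑ i, C (a i) * ((X - C β) ^ m i * G i) = 0) : a = 0 := by
  classical
  by_contra hne
  obtain ⟨j, hj⟩ : ∃ j, a j ≠ 0 := by
    by_contra! H
    exact hne (funext H)
  obtain ⟨i₀, hi₀, hmin⟩ := Finset.exists_min_image (Finset.univ.filter fun i => a i ≠ 0) m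
    ⟨j, by simpa using hj⟩
  have hdvd : (X - C β) ^ (m i₀ + 1) ∣ C (a i₀) * ((X - C β) ^ m i₀ * G i₀) := by
    rw [← Finset.add_sum_erase _ _ (Finset.mem_univ i₀)] at h
    rw [eq_neg_of_add_eq_zero_left h, dvd_neg]
    refine Finset.dvd_sum fun i hi => ?_
    by_cases hai : a i = 0
    · simp [hai]
    · have h1 := hmin i (by simpa using hai)
      have h2 : m i₀ ≠ m i := fun h => (Finset.ne_of_mem_erase hi) (hm h).symm
      exact ((pow_dvd_pow _ (by omega)).mul_right _).mul_left _
  rw [pow_succ, mul_left_comm, mul_dvd_mul_iff_left (pow_ne_zero _ (X_sub_C_ne_zero β)),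
    dvd_iff_isRoot, IsRoot, eval_mul, eval_C] at hdvd
  exact mul_ne_zero (by simpa using hi₀) (hG i₀) hdvd

/-- Stepanov's bound on the number of points of `z ^ (s * s) = z` at which a power of `A / B` takes
a prescribed value. -/
theorem stepanov_bound {L : Type*} [Field L] [IsAlgClosed L] (p k : ℕ) [ExpChar L p]
    {s M t D : ℕ} (hsp : s = p ^ k) (hs : s = M * t + 1) (hM : 2 ≤ M) (ht : 1 ≤ t)
    {A B B₁ : L[X]} {β : L} (hAD : A.natDegree ≤ D) (hBD : B.natDegree ≤ D)
    (hA : A.eval β ≠ 0) (hB : B = (X - C β) * B₁) (hB₁ : B₁.eval β ≠ 0) (c : L)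
    (S : Finset L) (hS : ∀ z ∈ S, z ^ (s * s) = z ∧ A.eval z ≠ 0 ∧ B.eval z ≠ 0 ∧
      A.eval z ^ ((s + 1) * t) = c * B.eval z ^ ((s + 1) * t)) :
    M * S.card ≤ s * s + M * (4 * D + 3) * s := by
  have hpow : ∀ x y : L, (x - y) ^ s = x ^ s - y ^ s := fun x y => by
    rw [hsp]; exact sub_pow_expChar_pow x y k
  have hpow2 : ∀ x y : L, (x - y) ^ (s * s) = x ^ (s * s) - y ^ (s * s) := fun x y => by
    rw [pow_mul, hpow, hpow, ← pow_mul, ← pow_mul]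
  have hmt : 2 * t ≤ M * t := Nat.mul_le_mul_right t hM
  set K := t + 3 * D + 3 with hK
  let T : Fin M × Fin K × Fin t → L[X] := fun x =>
    C (c ^ (x.1 : ℕ)) * ((X - C β) ^ ((x.2.2 : ℕ) * s) * (X - C (β ^ (s * s))) ^ (x.2.1 : ℕ) *
      A ^ ((M - 1 - x.1) * t) * B ^ ((x.1 : ℕ) * t))
  set N := t * s + K + s * D with hN
  have hjD : ∀ j : Fin M, (M - 1 - j) * t * D + (j : ℕ) * t * D ≤ s * D := fun j => by
    have : (M - 1 - j) * t + (j : ℕ) * t ≤ s := by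
      rw [← add_mul, hs]
      have := j.2
      exact (Nat.mul_le_mul_right t (by omega)).trans (Nat.le_succ _)
    calc _ = ((M - 1 - j) * t + (j : ℕ) * t) * D := by ring
      _ ≤ _ := Nat.mul_le_mul_right D this
  have hTdeg : ∀ x, T x ∈ degreeLT L N := fun x => by
    rw [mem_degreeLT]
    refine lt_of_le_of_lt degree_le_natDegree ?_
    rw [Nat.cast_lt]
    have h1 : (T x).natDegree ≤ 0 + ((x.2.2 : ℕ) * s * 1 + (x.2.1 : ℕ) * 1 +
        (M - 1 - x.1) * t * D + (x.1 : ℕ) * t * D) := by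
      refine natDegree_mul_le_of_le (natDegree_C _).le (natDegree_mul_le_of_le
        (natDegree_mul_le_of_le (natDegree_mul_le_of_le ?_ ?_) ?_) ?_)
      · exact natDegree_pow_le_of_le _ (natDegree_X_sub_C_le _)
      · exact natDegree_pow_le_of_le _ (natDegree_X_sub_C_le _)
      · exact natDegree_pow_le_of_le _ hAD
      · exact natDegree_pow_le_of_le _ hBD
    have h2 := hjD x.1
    have h3 : (x.2.2 : ℕ) * s ≤ t * s := Nat.mul_le_mul_right s x.2.2.2.le
    have h4 := x.2.1.2
    omega
  let f : (Fin M × Fin K × Fin t → L) →ₗ[L] degreeLT L N :=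
    Fintype.linearCombination L fun x => (⟨T x, hTdeg x⟩ : degreeLT L N)
  have hf : ∀ a, (f a : L[X]) = ∑ x, C (a x) * T x := fun a => by
    simp [f, Fintype.linearCombination_apply, smul_eq_C_mul]
  have hker : LinearMap.ker f ≠ ⊥ := by
    apply LinearMap.ker_ne_bot_of_finrank_lt
    rw [LinearEquiv.finrank_eq (degreeLTEquiv L N), Module.finrank_fin_fun,
      Module.finrank_fintype_fun_eq_card]
    simp only [Fintype.card_prod, Fintype.card_fin]
    have h1 : M * (K * t) = (s - 1) * K := by
      rw [hs]; simp only [Nat.add_sub_cancel]; ring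
    obtain ⟨u, rfl⟩ : ∃ u, s = u + 3 := ⟨s - 3, by omega⟩
    rw [h1, hN, hK]
    simp only [show u + 3 - 1 = u + 2 from rfl]
    nlinarith [Nat.zero_le (u * D)]
  obtain ⟨a, ha, hane⟩ := (Submodule.ne_bot_iff _).1 hker
  choose b hb using fun x => IsAlgClosed.exists_pow_nat_eq (a x) (n := s) (by omega)
  have hbne : b ≠ 0 := by
    rintro rfl
    apply hane
    funext x
    rw [← hb x]
    simp [show s ≠ 0 by omega]
  let W : L[X] := ∑ x : Fin M × Fin K × Fin t, C (b x) *
    ((X - C β) ^ ((x.2.2 : ℕ) + x.2.1 * s) * A ^ ((x.1 : ℕ) * t) * B ^ ((M - 1 - x.1) * t))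
  have hWne : W ≠ 0 := by
    intro hW
    apply hbne
    refine eq_zero_of_sum_X_sub_C_pow_mul_eq_zero β
      (fun x : Fin M × Fin K × Fin t => (x.2.2 : ℕ) + x.2.1 * s + (M - 1 - x.1) * t) ?_
      (fun x => A ^ ((x.1 : ℕ) * t) * B₁ ^ ((M - 1 - x.1) * t)) ?_ b ?_
    · rintro ⟨j, l, i⟩ ⟨j', l', i'⟩ h
      simp only at h
      have key : ∀ (j : Fin M) (i : Fin t), (i : ℕ) + (M - 1 - j) * t < s := fun j i => by
        have h1 : (M - 1 - j) * t ≤ (M - 1) * t := Nat.mul_le_mul_right t (by omega)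
        have h2 : M * t = (M - 1) * t + t := by
          obtain ⟨u, rfl⟩ : ∃ u, M = u + 1 := ⟨M - 1, by omega⟩
          simp [add_mul]
        have := i.2
        omega
      have h1 : (l : ℕ) = l' := by
        have e := congrArg (· / s) h
        rwa [show (i : ℕ) + l * s + (M - 1 - j) * t = (i + (M - 1 - j) * t) + l * s by ring,
          show (i' : ℕ) + l' * s + (M - 1 - j') * t = (i' + (M - 1 - j') * t) + l' * s by ring,
          Nat.add_mul_div_right _ _ (by omega), Nat.add_mul_div_right _ _ (by omega),
          Nat.div_eq_of_lt (key _ _), Nat.div_eq_of_lt (key _ _), zero_add, zero_add] at e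
      have h2 : (i : ℕ) + (M - 1 - j) * t = i' + (M - 1 - j') * t := by
        rw [h1] at h; omega
      have h3 : M - 1 - (j : ℕ) = M - 1 - j' := by
        have e := congrArg (· / t) h2
        rwa [Nat.add_mul_div_right _ _ (by omega), Nat.add_mul_div_right _ _ (by omega),
          Nat.div_eq_of_lt i.2, Nat.div_eq_of_lt i'.2, zero_add, zero_add] at e
      have h4 : (i : ℕ) = i' := by rw [h3] at h2; omega
      have hj := j.2
      have hj' := j'.2
      simp only [Prod.mk.injEq, Fin.ext_iff]
      omega
    · intro x
      rw [eval_mul, eval_pow, eval_pow]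
      exact mul_ne_zero (pow_ne_zero _ hA) (pow_ne_zero _ hB₁)
    · rw [← hW]
      refine Finset.sum_congr rfl fun x _ => ?_
      rw [hB, mul_pow, pow_add (X - C β) ((x.2.2 : ℕ) + x.2.1 * s)]
      ring
  have hWdeg : W.natDegree ≤ t + K * s + s * D := by
    refine natDegree_sum_le_of_forall_le _ _ fun x _ => ?_
    have h1 : (C (b x) * ((X - C β) ^ ((x.2.2 : ℕ) + x.2.1 * s) * A ^ ((x.1 : ℕ) * t) *
        B ^ ((M - 1 - x.1) * t))).natDegree ≤
        0 + (((x.2.2 : ℕ) + x.2.1 * s) * 1 + (x.1 : ℕ) * t * D + (M - 1 - x.1) * t * D) := by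
      refine natDegree_mul_le_of_le (natDegree_C _).le (natDegree_mul_le_of_le
        (natDegree_mul_le_of_le ?_ ?_) ?_)
      · exact natDegree_pow_le_of_le _ (natDegree_X_sub_C_le _)
      · exact natDegree_pow_le_of_le _ hAD
      · exact natDegree_pow_le_of_le _ hBD
    have h2 := hjD x.1
    have h3 : (x.2.1 : ℕ) * s ≤ K * s := Nat.mul_le_mul_right s x.2.1.2.le
    have h4 := x.2.2.2
    omega
  have hroot : ∀ z ∈ S, W.eval z = 0 := by
    intro z hz
    obtain ⟨hzs, hAz, hBz, hABz⟩ := hS z hz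
    set u := A.eval z
    set v := B.eval z
    have h0 : (∑ x, C (a x) * T x).eval z = 0 := by
      rw [← hf, LinearMap.mem_ker.1 ha]; simp
    have h1 : W.eval z ^ s * (u * v) ^ ((M - 1) * t) = v ^ ((M - 1) * ((s + 1) * t)) *
        (∑ x, C (a x) * T x).eval z := by
      have e1 : W.eval z ^ s = ∑ x : Fin M × Fin K × Fin t, (b x *
        ((z - β) ^ ((x.2.2 : ℕ) + x.2.1 * s) * u ^ ((x.1 : ℕ) * t) *
          v ^ ((M - 1 - x.1) * t))) ^ s := by
        have : W.eval z = ∑ x : Fin M × Fin K × Fin t, b x *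
            ((z - β) ^ ((x.2.2 : ℕ) + x.2.1 * s) * u ^ ((x.1 : ℕ) * t) *
            v ^ ((M - 1 - x.1) * t)) := by
          simp [W, eval_finsetSum, u, v]
        rw [this, hsp, sum_pow_char_pow]
      rw [e1, eval_finsetSum, Finset.sum_mul, Finset.mul_sum]
      refine Finset.sum_congr rfl fun ⟨j, l, i⟩ _ => ?_
      simp only [T, eval_mul, eval_C, eval_pow, eval_sub, eval_X]
      have e2 : (z - β ^ (s * s)) = (z - β) ^ (s * s) := by rw [hpow2, hzs]
      have e3 : u ^ ((j : ℕ) * ((s + 1) * t)) = c ^ (j : ℕ) * v ^ ((j : ℕ) * ((s + 1) * t)) := by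
        rw [mul_comm (j : ℕ), pow_mul, hABz, mul_pow, ← pow_mul]
      obtain ⟨j', hj'⟩ : ∃ j', M - 1 = j + j' := ⟨M - 1 - j, by have := j.2; omega⟩
      rw [e2, hj', Nat.add_sub_cancel_left]
      calc _ = (b (j, l, i)) ^ s * (z - β) ^ ((i : ℕ) * s) * (z - β) ^ (s * s * l) *
            u ^ ((j : ℕ) * ((s + 1) * t)) * u ^ (j' * t) * v ^ (j' * t * s + (j + j') * t) := by
              ring
        _ = _ := by
              rw [e3, hb]; ring
    rw [h0, mul_zero] at h1
    exact (pow_eq_zero_iff (by omega)).1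
      ((mul_eq_zero.1 h1).resolve_right (pow_ne_zero _ (mul_ne_zero hAz hBz)))
  have hcard : S.card ≤ t + K * s + s * D := by
    classical
    refine le_trans ?_ ((card_roots' W).trans hWdeg)
    refine (Finset.card_le_card fun z hz => ?_).trans (Multiset.toFinset_card_le _)
    rw [Multiset.mem_toFinset, mem_roots hWne]
    exact hroot z hz
  calc M * S.card ≤ M * (t + K * s + s * D) := Nat.mul_le_mul_left M hcard
    _ = M * t + M * t * s + M * (4 * D + 3) * s := by rw [hK]; ring
    _ ≤ _ := by
      have : M * t = s - 1 := by omega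
      rw [this]
      have : (s - 1) + (s - 1) * s ≤ s * s := by
        obtain ⟨u, rfl⟩ : ∃ u, s = u + 1 := ⟨s - 1, by omega⟩
        simp only [Nat.add_sub_cancel]
        nlinarith
      omega

end Stepanov

section LogDerivative

open Polynomial Filter Topology

theorem hasSum_coeff_mul_pow (P : ℂ[X]) (z : ℂ) :
    HasSum (fun k => P.coeff k * z ^ k) (P.eval z) := by
  rw [eval_eq_sum_range]
  refine hasSum_sum_of_ne_finset_zero fun k hk => ?_
  rw [coeff_eq_zero_of_natDegree_lt (by simpa using hk), zero_mul]

theorem one_le_mul_norm_of_isRoot_of_logDeriv {P : ℂ[X]} (hP : P.coeff 0 = 1) {R : ℕ → ℂ}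
    {C ρ : ℝ} (hρ : 0 ≤ ρ) (hR : ∀ r, ‖R r‖ ≤ C * ρ ^ r)
    (h : (P : PowerSeries ℂ) * PowerSeries.mk R = ((X * derivative P : ℂ[X]) : PowerSeries ℂ))
    {z₀ : ℂ} (hz : P.IsRoot z₀) : 1 ≤ ρ * ‖z₀‖ := by
  by_contra! hlt
  have hP0 : P ≠ 0 := by rintro rfl; simp at hP
  have hC : 0 ≤ C := by simpa using (norm_nonneg _).trans (hR 0)
  have hz0 : z₀ ≠ 0 := by
    rintro rfl
    rw [IsRoot, ← coeff_zero_eq_eval_zero, hP] at hz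
    exact one_ne_zero hz
  have key : ∀ z : ℂ, ρ * ‖z‖ < 1 →
      ‖(X * derivative P).eval z‖ ≤ ‖P.eval z‖ * (C * (1 - ρ * ‖z‖)⁻¹) := by
    intro z hz
    have hb : ∀ r, ‖R r * z ^ r‖ ≤ C * (ρ * ‖z‖) ^ r := fun r => by
      rw [norm_mul, norm_pow, mul_pow, ← mul_assoc]
      exact mul_le_mul_of_nonneg_right (hR r) (by positivity)
    have hg := (hasSum_geometric_of_lt_one (by positivity) hz).mul_left C
    have hsR : Summable fun r => ‖R r * z ^ r‖ :=
      Summable.of_nonneg_of_le (fun _ => norm_nonneg _) hb hg.summable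
    have hsP : Summable fun r => ‖P.coeff r * z ^ r‖ :=
      (hasSum_coeff_mul_pow P z).summable.norm
    have e := tsum_mul_tsum_eq_tsum_sum_antidiagonal_of_summable_norm hsP hsR
    have e2 : ∀ k, ∑ x ∈ Finset.HasAntidiagonal.antidiagonal k,
        P.coeff x.1 * z ^ x.1 * (R x.2 * z ^ x.2) =
        (X * derivative P).coeff k * z ^ k := fun k => by
      rw [← Polynomial.coeff_coe, ← h, PowerSeries.coeff_mul, Finset.sum_mul]
      refine Finset.sum_congr rfl fun x hx => ?_
      rw [← Finset.HasAntidiagonal.mem_antidiagonal.1 hx, pow_add, PowerSeries.coeff_mk,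
        Polynomial.coeff_coe]
      ring
    rw [(hasSum_coeff_mul_pow P z).tsum_eq, tsum_congr e2,
      (hasSum_coeff_mul_pow (X * derivative P) z).tsum_eq] at e
    rw [← e, norm_mul]
    exact mul_le_mul_of_nonneg_left (tsum_of_norm_bounded hg hb) (norm_nonneg _)
  obtain ⟨G, hG, hGr⟩ := exists_eq_pow_rootMultiplicity_mul_and_not_dvd P hP0 z₀
  have hG0 : G.eval z₀ ≠ 0 := fun h => hGr (dvd_iff_isRoot.2 h)
  obtain ⟨m, hm⟩ : ∃ m, P.rootMultiplicity z₀ = m + 1 :=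
    Nat.exists_eq_succ_of_ne_zero ((rootMultiplicity_pos hP0).2 hz).ne'
  rw [hm] at hG
  let H : ℂ[X] := X * (((m : ℂ[X]) + 1) * G + (X - Polynomial.C z₀) * derivative G)
  have hXP : X * derivative P = (X - Polynomial.C z₀) ^ m * H := by
    rw [hG]
    simp only [derivative_mul, derivative_X_sub_C_pow, H]
    push_cast
    simp only [map_add, map_natCast, map_one, pow_succ]
    ring
  set c : ℝ := (1 + ρ * ‖z₀‖) / 2 with hc
  have hbound : ∀ᶠ z in 𝓝[≠] z₀, ‖H.eval z‖ ≤ ‖z - z₀‖ * ‖G.eval z‖ * (C * (1 - c)⁻¹) := by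
    have h1 : ∀ᶠ z in 𝓝 z₀, ρ * ‖z‖ < c :=
      (continuous_const.mul continuous_norm).continuousAt.eventually_lt_const
        (show ρ * ‖z₀‖ < c by rw [hc]; linarith)
    filter_upwards [nhdsWithin_le_nhds h1, self_mem_nhdsWithin] with z hz hne
    have hne : z - z₀ ≠ 0 := sub_ne_zero.2 hne
    have h2 := key z (by rw [hc] at hz; linarith)
    rw [hXP, hG] at h2
    simp only [eval_mul, eval_pow, eval_sub, eval_X, eval_C, norm_mul, norm_pow, pow_succ] at h2
    have h3 : 0 < ‖z - z₀‖ ^ m := pow_pos (norm_pos_iff.2 hne) m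
    have h4 : ‖eval z H‖ ≤ ‖z - z₀‖ * ‖eval z G‖ * (C * (1 - ρ * ‖z‖)⁻¹) :=
      le_of_mul_le_mul_left (h2.trans (le_of_eq (by ring))) h3
    refine h4.trans (mul_le_mul_of_nonneg_left (mul_le_mul_of_nonneg_left ?_ hC) (by positivity))
    exact inv_anti₀ (by rw [hc]; linarith) (by linarith)
  have hlim1 : Tendsto (fun z => ‖H.eval z‖) (𝓝[≠] z₀) (𝓝 ‖H.eval z₀‖) :=
    (H.continuous.norm.tendsto z₀).mono_left nhdsWithin_le_nhds
  have hlim2 : Tendsto (fun z => ‖z - z₀‖ * ‖G.eval z‖ * (C * (1 - c)⁻¹)) (𝓝[≠] z₀)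
      (𝓝 (‖z₀ - z₀‖ * ‖G.eval z₀‖ * (C * (1 - c)⁻¹))) :=
    (((((continuous_id.sub continuous_const).norm).mul G.continuous.norm).mul
      continuous_const).tendsto z₀).mono_left nhdsWithin_le_nhds
  have hle := le_of_tendsto_of_tendsto hlim1 hlim2 hbound
  simp only [sub_self, norm_zero, zero_mul, norm_le_zero_iff, H, eval_mul, eval_add, eval_X,
    eval_sub, eval_C, add_zero, eval_natCast, eval_one, mul_eq_zero, hz0, hG0, or_false,
    false_or] at hle
  exact Nat.cast_add_one_ne_zero m hle

theorem norm_coeff_one_le_of_roots {P : ℂ[X]} (hP : P.coeff 0 = 1) {ρ : ℝ}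
    (h : ∀ z, P.IsRoot z → 1 ≤ ρ * ‖z‖) : ‖P.coeff 1‖ ≤ P.natDegree * ρ := by
  rcases Nat.eq_zero_or_pos P.natDegree with hd | hd
  · rw [coeff_eq_zero_of_natDegree_lt (by omega), hd]; simp
  have htd : P.natTrailingDegree = 0 :=
    Nat.le_zero.1 (natTrailingDegree_le_of_ne_zero (by rw [hP]; exact one_ne_zero))
  have hmon : P.reverse.Monic := by
    rw [Monic, reverse_leadingCoeff, trailingCoeff, htd, hP]
  have hdeg : P.reverse.natDegree = P.natDegree := by rw [reverse_natDegree, htd, Nat.sub_zero]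
  have := coeff_le_of_roots_le (p := P.reverse) (f := RingHom.id ℂ) (B := ρ) (P.natDegree - 1)
    hmon (IsAlgClosed.splits _) fun z hz => by
      rw [Polynomial.map_id, mem_roots hmon.ne_zero] at hz
      have hz0 : z ≠ 0 := by
        rintro rfl
        rw [IsRoot, ← coeff_zero_eq_eval_zero, coeff_zero_reverse, leadingCoeff_eq_zero] at hz
        simp [hz] at hd
      have := invertibleOfNonzero (inv_ne_zero hz0)
      have h1 := h z⁻¹ (by
        have := (eval₂_reverse_eq_zero_iff (RingHom.id ℂ) z⁻¹ P).1
        simpa [eval₂_id] using this (by simpa [eval₂_id] using hz))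
      rw [norm_inv, ← div_eq_mul_inv, one_le_div (norm_pos_iff.2 hz0)] at h1
      exact h1
  rw [Polynomial.map_id, hdeg, coeff_reverse, revAt_le (by omega),
    show P.natDegree - (P.natDegree - 1) = 1 by omega, pow_one, Nat.choose_symm (by omega),
    Nat.choose_one_right, mul_comm] at this
  exact this

theorem norm_coeff_one_le_of_even_logDeriv {P : ℂ[X]} (hP : P.coeff 0 = 1) {S : ℕ → ℂ}
    (hS : ∀ k, k * P.coeff k = ∑ x ∈ Finset.HasAntidiagonal.antidiagonal k, P.coeff x.1 * S x.2)
    {C ρ : ℝ} (hρ : 0 ≤ ρ) (hbound : ∀ r, ‖S (2 * r)‖ ≤ C * ρ ^ (2 * r)) :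
    ‖P.coeff 1‖ ≤ P.natDegree * ρ := by
  have hC : 0 ≤ C := by simpa using (norm_nonneg _).trans (hbound 0)
  have h1 : (P : PowerSeries ℂ) * PowerSeries.mk S =
      ((X * derivative P : ℂ[X]) : PowerSeries ℂ) := by
    ext k
    rw [PowerSeries.coeff_mul, Polynomial.coeff_coe]
    simp only [PowerSeries.coeff_mk, Polynomial.coeff_coe]
    cases k with
    | zero => rw [← hS]; simp
    | succ k => rw [← hS, coeff_X_mul, coeff_derivative]; push_cast; ring
  set P' : ℂ[X] := P.comp (Polynomial.C (-1) * X) with hP'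
  have hP'c : ∀ k, P'.coeff k = (-1) ^ k * P.coeff k := fun k => by
    rw [hP', comp_C_mul_X_coeff, mul_comm]
  have h2 : (P' : PowerSeries ℂ) * PowerSeries.mk (fun r => (-1) ^ r * S r) =
      ((X * derivative P' : ℂ[X]) : PowerSeries ℂ) := by
    ext k
    rw [PowerSeries.coeff_mul, Polynomial.coeff_coe]
    simp only [PowerSeries.coeff_mk, Polynomial.coeff_coe, hP'c]
    have : (X * derivative P').coeff k = (-1) ^ k * (k * P.coeff k) := by
      cases k with
      | zero => simp
      | succ k => rw [coeff_X_mul, coeff_derivative, hP'c]; push_cast; ring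
    rw [this, hS, Finset.mul_sum]
    refine Finset.sum_congr rfl fun x hx => ?_
    rw [← Finset.HasAntidiagonal.mem_antidiagonal.1 hx, pow_add]; ring
  have h3 : ((P * P' : ℂ[X]) : PowerSeries ℂ) *
      PowerSeries.mk (fun r => S r + (-1) ^ r * S r) =
      ((X * derivative (P * P') : ℂ[X]) : PowerSeries ℂ) := by
    have : PowerSeries.mk (fun r => S r + (-1) ^ r * S r) =
      PowerSeries.mk S + PowerSeries.mk (fun r => (-1) ^ r * S r) := by ext; simp
    rw [this, derivative_mul, show X * (derivative P * P' + P * derivative P') =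
      (X * derivative P) * P' + P * (X * derivative P') by ring, Polynomial.coe_add,
      Polynomial.coe_mul, Polynomial.coe_mul (X * _), Polynomial.coe_mul P (X * _), ← h1, ← h2]
    ring
  refine norm_coeff_one_le_of_roots hP fun z hz => ?_
  refine one_le_mul_norm_of_isRoot_of_logDeriv (P := P * P') (C := 2 * C)
    (by rw [mul_coeff_zero, hP'c, hP]; simp) hρ (fun r => ?_) h3 (by
      rw [IsRoot, eval_mul, hz.eq_zero, zero_mul])
  rcases Nat.even_or_odd r with hr | hr
  · obtain ⟨m, rfl⟩ := hr
    rw [← two_mul, pow_mul (-1 : ℂ), neg_one_sq, one_pow, one_mul, ← two_mul, norm_mul,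
      RCLike.norm_ofNat, mul_assoc]
    exact mul_le_mul_of_nonneg_left (hbound m) (by norm_num)
  · rw [hr.neg_one_pow, neg_one_mul, add_neg_cancel, norm_zero]
    positivity

end LogDerivative

section EulerProduct

open Polynomial

theorem finite_setOf_monic_natDegree_eq (F : Type*) [Field F] [Finite F] (k : ℕ) :
    {g : F[X] | g.Monic ∧ g.natDegree = k}.Finite :=
  @Set.toFinite _ {g : F[X] | g.Monic ∧ g.natDegree = k}
    (Finite.of_equiv _ ((monicEquivDegreeLT k).trans (degreeLTEquiv F k).toEquiv).symm)

/-- The finite set of monic polynomials of degree `k` over a finite field. -/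
noncomputable def monicsOfNatDegree (F : Type*) [Field F] [Finite F] (k : ℕ) : Finset F[X] :=
  (finite_setOf_monic_natDegree_eq F k).toFinset

theorem mem_monicsOfNatDegree {F : Type*} [Field F] [Finite F] {k : ℕ} {g : F[X]} :
    g ∈ monicsOfNatDegree F k ↔ g.Monic ∧ g.natDegree = k := by
  simp [monicsOfNatDegree]

variable (F L : Type*) [Field F] [Finite F] [Field L] [Algebra F L]

open Classical in
/-- For `0 < r`, the elements of `L` fixed by the `r`-th power of the Frobenius of `F`. -/
noncomputable def frobFixed (r : ℕ) : Finset L :=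
  (X ^ Nat.card F ^ r - X : L[X]).roots.toFinset

variable {F L}

omit [Algebra F L] in
theorem mem_frobFixed {r : ℕ} {z : L} :
    z ∈ frobFixed F L r ↔ r ≠ 0 ∧ z ^ Nat.card F ^ r = z := by
  rcases eq_or_ne r 0 with rfl | hr
  · simp [frobFixed]
  · simp [frobFixed, FiniteField.X_pow_card_pow_sub_X_ne_zero L hr (Finite.one_lt_card (α := F)),
      hr, sub_eq_zero]

variable [Algebra.IsAlgebraic F L]

theorem natDegree_minpoly_dvd_iff {r : ℕ} {z : L} :
    (minpoly F z).natDegree ∣ r ↔ z ^ Nat.card F ^ r = z := by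
  have hirr := minpoly.irreducible (Algebra.IsIntegral.isIntegral (R := F) z)
  rw [hirr.natDegree_dvd_iff_dvd_X_pow_card_pow_sub_X,
    minpoly.dvd_iff]
  simp [sub_eq_zero]

theorem mem_frobFixed_iff_dvd {r : ℕ} {z : L} :
    z ∈ frobFixed F L r ↔ r ≠ 0 ∧ (minpoly F z).natDegree ∣ r := by
  rw [mem_frobFixed, natDegree_minpoly_dvd_iff]

theorem minpoly_pow_dvd_iff {g : F[X]} (hg : g ≠ 0) {z : L} {e : ℕ} :
    minpoly F z ^ e ∣ g ↔ e ≤ (g.map (algebraMap F L)).rootMultiplicity z := by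
  have hintegral : IsIntegral F z := Algebra.IsIntegral.isIntegral z
  have hmap : ∀ {f : F[X]}, f ≠ 0 → f.map (algebraMap F L) ≠ 0 := fun h =>
    (Polynomial.map_ne_zero_iff (algebraMap F L).injective).2 h
  have hP0 : minpoly F z ≠ 0 := minpoly.ne_zero hintegral
  have hPz : ((minpoly F z).map (algebraMap F L)).IsRoot z := by
    rw [IsRoot, eval_map_algebraMap, minpoly.aeval]
  have hsep := (PerfectField.separable_of_irreducible (minpoly.irreducible hintegral)).map
    (f := algebraMap F L)
  obtain ⟨h, hgh, hPh⟩ := (finiteMultiplicity_of_degree_pos_of_monic (minpoly.degree_pos hintegral)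
    (minpoly.monic hintegral) hg).exists_eq_pow_mul_and_not_dvd
  set m := multiplicity (minpoly F z) g
  have hh0 : h ≠ 0 := by rintro rfl; simp at hPh
  obtain ⟨G, hG⟩ := dvd_iff_isRoot.2 hPz
  have hGz : G.eval z ≠ 0 := fun h0 => by
    have := (rootMultiplicity_le_one_of_separable hsep z)
    have h2 : 1 < rootMultiplicity z ((minpoly F z).map (algebraMap F L)) := by
      rw [← Nat.succ_le_iff, le_rootMultiplicity_iff (hmap hP0), hG, Nat.succ_eq_add_one,
        pow_succ, pow_one]
      exact mul_dvd_mul_left _ (dvd_iff_isRoot.2 h0)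
    omega
  have hmult : (g.map (algebraMap F L)).rootMultiplicity z = m := by
    have e1 : g.map (algebraMap F L) =
        (X - C z) ^ m * (G ^ m * h.map (algebraMap F L)) := by
      rw [hgh, Polynomial.map_mul, Polynomial.map_pow, hG, mul_pow, mul_assoc]
    have e2 : (G ^ m * h.map (algebraMap F L)).eval z ≠ 0 := by
      rw [eval_mul, eval_pow]
      refine mul_ne_zero (pow_ne_zero _ hGz) ?_
      rw [eval_map_algebraMap]
      exact fun h0 => hPh (minpoly.dvd _ _ h0)
    have e3 : (g.map (algebraMap F L)) ≠ 0 := hmap hg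
    rw [e1] at e3 ⊢
    rw [rootMultiplicity_mul e3, rootMultiplicity_X_sub_C_pow,
      rootMultiplicity_eq_zero (by exact e2), add_zero]
  rw [hmult]
  constructor
  · intro hd
    by_contra! hlt
    have h1 : minpoly F z ^ (m + 1) ∣ g := (pow_dvd_pow _ hlt).trans hd
    rw [hgh, pow_succ, mul_dvd_mul_iff_left (pow_ne_zero _ hP0)] at h1
    exact hPh h1
  · intro hle
    rw [hgh]
    exact (pow_dvd_pow _ hle).mul_right _

variable [IsAlgClosed L]

open Classical in
theorem sum_card_filter_minpoly_pow_dvd {g : F[X]} {k : ℕ} (hg : g ∈ monicsOfNatDegree F k) :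
    ∑ r ∈ Finset.range (k + 1), ((frobFixed F L r).filter fun z =>
      minpoly F z ^ (r / (minpoly F z).natDegree) ∣ g).card = k := by
  obtain ⟨hmon, hdeg⟩ := mem_monicsOfNatDegree.1 hg
  have hg0 := hmon.ne_zero
  have hgm : g.map (algebraMap F L) ≠ 0 := (hmon.map _).ne_zero
  have h1 : ∀ r ∈ Finset.range (k + 1), ((frobFixed F L r).filter fun z =>
      minpoly F z ^ (r / (minpoly F z).natDegree) ∣ g).card =
      ((g.map (algebraMap F L)).roots.toFinset.bipartiteAbove (fun r z =>
        z ∈ frobFixed F L r ∧ minpoly F z ^ (r / (minpoly F z).natDegree) ∣ g) r).card := by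
    intro r _
    congr 1
    ext z
    simp only [Finset.mem_filter, Finset.mem_bipartiteAbove, Multiset.mem_toFinset,
      mem_roots hgm]
    refine ⟨fun h => ⟨?_, h⟩, fun h => h.2⟩
    obtain ⟨hr, hd⟩ := mem_frobFixed_iff_dvd.1 h.1
    have := (minpoly_pow_dvd_iff hg0).1 h.2
    rw [← rootMultiplicity_pos hgm]
    exact lt_of_lt_of_le (Nat.div_pos (Nat.le_of_dvd (Nat.pos_of_ne_zero hr) hd)
      (minpoly.natDegree_pos (Algebra.IsIntegral.isIntegral z))) this
  rw [Finset.sum_congr rfl h1, Finset.sum_card_bipartiteAbove_eq_sum_card_bipartiteBelow]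
  have h2 : ∀ z ∈ (g.map (algebraMap F L)).roots.toFinset,
      ((Finset.range (k + 1)).bipartiteBelow (fun r z =>
        z ∈ frobFixed F L r ∧ minpoly F z ^ (r / (minpoly F z).natDegree) ∣ g) z).card =
      (g.map (algebraMap F L)).roots.count z := by
    intro z _
    have hδ := minpoly.natDegree_pos (Algebra.IsIntegral.isIntegral (R := F) z)
    rw [count_roots]
    have : (Finset.range (k + 1)).bipartiteBelow (fun r z =>
        z ∈ frobFixed F L r ∧ minpoly F z ^ (r / (minpoly F z).natDegree) ∣ g) z =
        (Finset.Icc 1 ((g.map (algebraMap F L)).rootMultiplicity z)).image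
          (fun i => (minpoly F z).natDegree * i) := by
      ext r
      simp only [Finset.mem_bipartiteBelow, Finset.mem_range, mem_frobFixed_iff_dvd,
        Finset.mem_image, Finset.mem_Icc]
      constructor
      · rintro ⟨_, ⟨hr, i, rfl⟩, h⟩
        rw [Nat.mul_div_cancel_left _ hδ, minpoly_pow_dvd_iff hg0] at h
        exact ⟨i, ⟨Nat.pos_of_ne_zero (right_ne_zero_of_mul hr), h⟩, rfl⟩
      · rintro ⟨i, ⟨hi, h⟩, rfl⟩
        have h' := (minpoly_pow_dvd_iff hg0).2 h
        have := natDegree_le_of_dvd h' hg0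
        rw [natDegree_pow, hdeg, mul_comm] at this
        refine ⟨by omega, ⟨by positivity, dvd_mul_right _ _⟩, ?_⟩
        rwa [Nat.mul_div_cancel_left _ hδ]
    rw [this, Finset.card_image_of_injective _ (mul_right_injective₀ hδ.ne')]
    simp
  rw [Finset.sum_congr rfl h2, Multiset.toFinset_sum_count_eq,
    splits_iff_card_roots.1 (IsAlgClosed.splits _), natDegree_map, hdeg]

open Classical in
theorem sum_monics_mul_of_monic (ψ : F[X] →* ℂ) {T : F[X]} (hT : T.Monic) {i : ℕ} :
    (∑ g ∈ monicsOfNatDegree F i, ψ g) * ψ T =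
      ∑ g ∈ monicsOfNatDegree F (i + T.natDegree), if T ∣ g then ψ g else 0 := by
  rw [← Finset.sum_filter, Finset.sum_mul]
  refine Finset.sum_bij (fun g _ => g * T) ?_ ?_ ?_ ?_
  · intro g hg
    obtain ⟨h1, h2⟩ := mem_monicsOfNatDegree.1 hg
    simp [mem_monicsOfNatDegree, h1.mul hT, h1.natDegree_mul hT, h2]
  · intro g _ g' _ h
    exact mul_right_cancel₀ hT.ne_zero h
  · intro g hg
    obtain ⟨hg, u, rfl⟩ := Finset.mem_filter.1 hg
    obtain ⟨h1, h2⟩ := mem_monicsOfNatDegree.1 hg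
    have hu := hT.of_mul_monic_left h1
    rw [hT.natDegree_mul hu, add_comm] at h2
    exact ⟨u, mem_monicsOfNatDegree.2 ⟨hu, Nat.add_right_cancel h2⟩, mul_comm _ _⟩
  · intro g _
    rw [map_mul]

variable (L) in
/-- The `r`-th coefficient of the logarithmic derivative of the `L`-series of `ψ`. -/
noncomputable def logDerivCoeff (ψ : F[X] →* ℂ) (r : ℕ) : ℂ :=
  ∑ z ∈ frobFixed F L r, ψ (minpoly F z ^ (r / (minpoly F z).natDegree))

theorem natCast_mul_sum_monics (ψ : F[X] →* ℂ) (k : ℕ) :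
    k * ∑ g ∈ monicsOfNatDegree F k, ψ g = ∑ x ∈ Finset.HasAntidiagonal.antidiagonal k,
      (∑ g ∈ monicsOfNatDegree F x.1, ψ g) * logDerivCoeff L ψ x.2 := by
  classical
  have h1 : ∀ x ∈ Finset.HasAntidiagonal.antidiagonal k,
      (∑ g ∈ monicsOfNatDegree F x.1, ψ g) * logDerivCoeff L ψ x.2 =
      ∑ g ∈ monicsOfNatDegree F k, (((frobFixed F L x.2).filter fun z =>
        minpoly F z ^ (x.2 / (minpoly F z).natDegree) ∣ g).card : ℂ) * ψ g := by
    intro x hx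
    rw [Finset.HasAntidiagonal.mem_antidiagonal] at hx
    have : ∀ z ∈ frobFixed F L x.2, (∑ g ∈ monicsOfNatDegree F x.1, ψ g) *
        ψ (minpoly F z ^ (x.2 / (minpoly F z).natDegree)) =
        ∑ g ∈ monicsOfNatDegree F k,
          if minpoly F z ^ (x.2 / (minpoly F z).natDegree) ∣ g then ψ g else 0 := fun z hz => by
      have hmon := minpoly.monic (Algebra.IsIntegral.isIntegral (R := F) z)
      rw [sum_monics_mul_of_monic ψ (hmon.pow _), natDegree_pow,
        Nat.div_mul_cancel (mem_frobFixed_iff_dvd.1 hz).2, hx]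
    rw [logDerivCoeff, Finset.mul_sum, Finset.sum_congr rfl this, Finset.sum_comm]
    refine Finset.sum_congr rfl fun g _ => ?_
    rw [← Finset.sum_filter, Finset.sum_const, nsmul_eq_mul]
  rw [Finset.sum_congr rfl h1, Finset.sum_comm, Finset.mul_sum]
  refine Finset.sum_congr rfl fun g hg => ?_
  rw [← Finset.sum_mul, ← Finset.Nat.sum_antidiagonal_swap]
  congr 1
  simp only [Prod.snd_swap]
  rw [Finset.Nat.sum_antidiagonal_eq_sum_range_succ (fun i _ => (((frobFixed F L i).filter fun z =>
        minpoly F z ^ (i / (minpoly F z).natDegree) ∣ g).card : ℂ)), ← Nat.cast_sum,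
    Nat.succ_eq_add_one, sum_card_filter_minpoly_pow_dvd hg]

omit [Algebra.IsAlgebraic F L] [IsAlgClosed L] in
theorem exists_algHom_eq_pow_card (i : ℕ) :
    ∃ φ : L →ₐ[F] L, ∀ x, φ x = x ^ Nat.card F ^ i := by
  let := Fintype.ofFinite F
  induction i with
  | zero => exact ⟨AlgHom.id F L, fun x => by simp⟩
  | succ i ih =>
    obtain ⟨φ, hφ⟩ := ih
    refine ⟨(FiniteField.frobeniusAlgHom F L).comp φ, fun x => ?_⟩
    rw [AlgHom.comp_apply, hφ, FiniteField.coe_frobeniusAlgHom, pow_succ, pow_mul,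
      Nat.card_eq_fintype_card]

omit [IsAlgClosed L] in
theorem map_minpoly_pow_eq_prod {r : ℕ} {z : L} (hz : z ∈ frobFixed F L r) :
    (minpoly F z ^ (r / (minpoly F z).natDegree)).map (algebraMap F L) =
      ∏ i ∈ Finset.range r, (X - C (z ^ Nat.card F ^ i)) := by
  have hintegral : IsIntegral F z := Algebra.IsIntegral.isIntegral z
  obtain ⟨_, e, rfl⟩ := mem_frobFixed_iff_dvd.1 hz
  set P := minpoly F z with hP
  set δ := P.natDegree with hδ
  have hδ0 : 0 < δ := minpoly.natDegree_pos hintegral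
  have hzδ : z ^ Nat.card F ^ δ = z := natDegree_minpoly_dvd_iff.1 dvd_rfl
  have hpow : ∀ (u v : L) (i : ℕ), u ^ Nat.card F ^ i = v ^ Nat.card F ^ i → u = v := by
    intro u v i h
    obtain ⟨φ, hφ⟩ := exists_algHom_eq_pow_card (F := F) (L := L) i
    rw [← hφ, ← hφ] at h
    exact φ.injective h
  have hbase : P.map (algebraMap F L) = ∏ i ∈ Finset.range δ, (X - C (z ^ Nat.card F ^ i)) := by
    refine eq_of_monic_of_dvd_of_natDegree_le (monic_prod_of_monic _ _ fun i _ =>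
      monic_X_sub_C _) ((minpoly.monic hintegral).map _) ?_ ?_
    · refine Finset.prod_dvd_of_coprime (fun i hi j hj hij => ?_) fun i _ => ?_
      · refine isCoprime_X_sub_C_of_isUnit_sub (IsUnit.mk0 _ (sub_ne_zero.2 fun h => hij ?_))
        wlog hlt : i ≤ j generalizing i j
        · exact (this j hj i hi hij.symm h.symm (by omega)).symm
        obtain ⟨l, rfl⟩ := Nat.exists_eq_add_of_le hlt
        rw [add_comm, pow_add, pow_mul] at h
        have h2 := Nat.eq_zero_of_dvd_of_lt (natDegree_minpoly_dvd_iff.2 (hpow _ _ i h).symm)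
          (by
            rw [← hP, ← hδ]
            have := Finset.mem_range.1 (Finset.mem_coe.1 hj)
            omega)
        omega
      · rw [dvd_iff_isRoot, IsRoot, eval_map_algebraMap]
        obtain ⟨φ, hφ⟩ := exists_algHom_eq_pow_card (F := F) (L := L) i
        rw [← hφ, aeval_algHom_apply, hP, minpoly.aeval, map_zero]
    · rw [natDegree_map, natDegree_prod_of_monic _ _ fun i _ => monic_X_sub_C _]
      simp only [natDegree_X_sub_C]
      simp [hδ]
  rw [Nat.mul_div_cancel_left _ hδ0, Polynomial.map_pow, hbase]
  clear * - hzδ hδ hP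
  induction e with
  | zero => simp
  | succ e ih =>
    rw [pow_succ, ih, mul_add, mul_one, Finset.prod_range_add]
    congr 1
    refine Finset.prod_congr rfl fun i _ => ?_
    rw [pow_add, pow_mul, natDegree_minpoly_dvd_iff.1 (dvd_mul_right _ _)]

end EulerProduct

section ResultantCharacter

open Polynomial

theorem sum_monics_eq_zero_of_periodic {F : Type*} [Field F] [Finite F] (ψ : F[X] →* ℂ)
    {m : F[X]} (hm : m.Monic) (hψ : ∀ g g', m ∣ g - g' → ψ g = ψ g') {h : F[X]}
    (hcop : IsCoprime m h) (hh : ψ h ≠ 1) {k : ℕ} (hk : m.natDegree ≤ k) :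
    ∑ g ∈ monicsOfNatDegree F k, ψ g = 0 := by
  let σ : F[X] → F[X] := fun g => g + ((h * g) %ₘ m - g %ₘ m)
  have hdvd : ∀ g, m ∣ σ g - h * g := fun g => by
    have h1 := modByMonic_add_div (h * g) m
    have h2 := modByMonic_add_div g m
    refine ⟨g /ₘ m - (h * g) /ₘ m, ?_⟩
    simp only [σ]
    linear_combination h1 - h2
  have hσψ : ∀ g, ψ (σ g) = ψ h * ψ g := fun g => by rw [hψ _ _ (hdvd g), map_mul]
  have hmaps : ∀ g ∈ monicsOfNatDegree F k, σ g ∈ monicsOfNatDegree F k := fun g hg => by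
    obtain ⟨h1, h2⟩ := mem_monicsOfNatDegree.1 hg
    have hlt : ((h * g) %ₘ m - g %ₘ m).degree < g.degree := by
      rw [← sub_modByMonic]
      refine (degree_modByMonic_lt _ hm).trans_le ?_
      rw [degree_eq_natDegree hm.ne_zero, degree_eq_natDegree h1.ne_zero, h2]
      exact_mod_cast hk
    exact mem_monicsOfNatDegree.2 ⟨h1.add_of_left hlt, by
      rw [← h2]; exact natDegree_add_eq_left_of_degree_lt hlt⟩
  have hinj : Set.InjOn σ (monicsOfNatDegree F k) := fun g _ g' _ hgg => by
    have h1 : m ∣ h * (g - g') := by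
      have := dvd_sub (hdvd g') (hdvd g)
      rw [hgg] at this
      convert this using 1
      ring
    have h2 := hcop.dvd_of_dvd_mul_left h1
    have h3 : (h * g) %ₘ m = (h * g') %ₘ m := by
      rw [← sub_eq_zero, ← sub_modByMonic, modByMonic_eq_zero_iff_dvd hm, ← mul_sub]; exact h1
    have h4 : g %ₘ m = g' %ₘ m := by
      rwa [← sub_eq_zero, ← sub_modByMonic, modByMonic_eq_zero_iff_dvd hm]
    simp only [σ, h3, h4] at hgg
    exact add_right_cancel hgg
  have hsum : ∑ g ∈ monicsOfNatDegree F k, ψ (σ g) = ∑ g ∈ monicsOfNatDegree F k, ψ g :=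
    Finset.sum_nbij σ hmaps hinj (Finset.surjOn_of_injOn_of_card_le σ hmaps hinj le_rfl)
      fun _ _ => rfl
  simp only [hσψ, ← Finset.mul_sum] at hsum
  by_contra hne
  exact hh (mul_right_cancel₀ hne (by rw [hsum, one_mul]))

section

variable {F : Type*} (L : Type*) [Field F] [Field L] [Algebra F L] [IsAlgClosed L]

theorem algebraMap_resultant_of_monic {A : F[X]} (hA : A.Monic) (g : F[X]) :
    algebraMap F L (A.resultant g) =
      ((A.map (algebraMap F L)).roots.map fun a => (g.map (algebraMap F L)).eval a).prod := by
  have h := resultant_eq_prod_eval (A.map (algebraMap F L)) (g.map (algebraMap F L)) g.natDegree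
    (natDegree_map _).le (IsAlgClosed.splits _)
  rwa [natDegree_map, resultant_map_map, (hA.map _).leadingCoeff, one_pow, one_mul] at h

end

variable {F : Type*} [Field F]

/-- The resultant with a fixed monic polynomial, as a multiplicative map. -/
noncomputable def resultantHom (A : F[X]) (hA : A.Monic) : F[X] →* F where
  toFun g := A.resultant g
  map_one' := by simp
  map_mul' g g' := by
    apply (algebraMap F (AlgebraicClosure F)).injective
    simp [algebraMap_resultant_of_monic (AlgebraicClosure F) hA, Multiset.prod_map_mul]

theorem resultantHom_congr {A : F[X]} (hA : A.Monic) {g g' : F[X]} (h : A ∣ g - g') :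
    resultantHom A hA g = resultantHom A hA g' := by
  apply (algebraMap F (AlgebraicClosure F)).injective
  refine (algebraMap_resultant_of_monic _ hA g).trans
    (Eq.trans ?_ (algebraMap_resultant_of_monic _ hA g').symm)
  congr 1
  refine Multiset.map_congr rfl fun a ha => ?_
  obtain ⟨u, hu⟩ := h
  rw [← sub_eq_zero, ← eval_sub, ← Polynomial.map_sub, hu, Polynomial.map_mul, eval_mul,
    (mem_roots (hA.map _).ne_zero).1 ha, zero_mul]

theorem resultantHom_mul_left {A B : F[X]} (hA : A.Monic) (hB : B.Monic) (g : F[X]) :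
    resultantHom (A * B) (hA.mul hB) g = resultantHom A hA g * resultantHom B hB g := by
  apply (algebraMap F (AlgebraicClosure F)).injective
  rw [map_mul]
  refine (algebraMap_resultant_of_monic _ (hA.mul hB) g).trans (Eq.trans ?_ (congrArg₂ _
    (algebraMap_resultant_of_monic _ hA g).symm (algebraMap_resultant_of_monic _ hB g).symm))
  rw [Polynomial.map_mul,
    roots_mul (by rw [← Polynomial.map_mul]; exact ((hA.mul hB).map _).ne_zero),
    Multiset.map_add, Multiset.prod_add]

theorem algebraMap_resultantHom_of_map_eq_prod (L : Type*) [Field L] [Algebra F L] [IsAlgClosed L]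
    {A : F[X]} (hA : A.Monic) {T : F[X]} {r : ℕ} {z : ℕ → L}
    (hT : T.map (algebraMap F L) = ∏ i ∈ Finset.range r, (X - C (z i))) :
    algebraMap F L (resultantHom A hA T) = (-1) ^ (A.natDegree * r) *
      ∏ i ∈ Finset.range r, (A.map (algebraMap F L)).eval (z i) := by
  refine (algebraMap_resultant_of_monic _ hA T).trans ?_
  have hs := IsAlgClosed.splits (A.map (algebraMap F L))
  have hcard : (A.map (algebraMap F L)).roots.card = A.natDegree := by
    rw [splits_iff_card_roots.1 hs, natDegree_map]
  have hev : ∀ i, ((A.map (algebraMap F L)).roots.map fun a => a - z i).prod =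
      (-1) ^ A.natDegree * (A.map (algebraMap F L)).eval (z i) := fun i => by
    rw [hs.eval_eq_prod_roots_of_monic (hA.map _), ← hcard, ← Multiset.prod_replicate,
      ← Multiset.map_const', ← Multiset.prod_map_mul]
    simp
  rw [hT, pow_mul,
    show ((-1 : L) ^ A.natDegree) ^ r = ∏ _i ∈ Finset.range r, (-1) ^ A.natDegree by simp,
    ← Finset.prod_mul_distrib]
  simp only [eval_prod, eval_sub, eval_X, eval_C]
  exact (Multiset.prod_map_prod_map _ (Finset.range r).val).trans
    (Finset.prod_congr rfl fun i _ => hev i)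

/-- The multiplicative function `g ↦ χ (Res(A, g) / Res(B, g))`. -/
noncomputable def resultantChar (χ : MulChar F ℂ) {A B : F[X]} (hA : A.Monic) (hB : B.Monic) :
    F[X] →* ℂ where
  toFun g := χ (resultantHom A hA g * (resultantHom B hB g)⁻¹)
  map_one' := by simp
  map_mul' g g' := by
    rw [← map_mul, map_mul (resultantHom A hA), map_mul (resultantHom B hB), mul_inv,
      mul_mul_mul_comm]

end ResultantCharacter

section Weil

open Polynomial

theorem sum_pow_eq_of_pow_eq {Q r s t : ℕ} (hQ : 2 ≤ Q) (hs : s = Q ^ r)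
    (hst : s = (Q - 1) * t + 1) : ∑ i ∈ Finset.range (2 * r), Q ^ i = (s + 1) * t := by
  rw [Nat.geomSum_eq hQ]
  apply Nat.div_eq_of_eq_mul_left (by omega)
  have : Q ^ (2 * r) = s * s := by rw [hs]; ring
  rw [this]
  have h1 : s * s = (s + 1) * t * (Q - 1) + 1 := by
    calc s * s = s * ((Q - 1) * t) + s := by nth_rw 2 [hst]; ring
      _ = s * ((Q - 1) * t) + ((Q - 1) * t + 1) := by rw [← hst]
      _ = _ := by ring
  omega

variable {F : Type*} [Field F] [Finite F]

theorem resultantHom_eq_norm_mk {P : F[X]} (hP : P.Monic) [Fact (Irreducible P)] (η : F[X]) :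
    resultantHom P hP η = Algebra.norm F (AdjoinRoot.mk P η) := by
  have hirr : Irreducible P := Fact.out
  obtain ⟨z, hz⟩ := IsAlgClosed.exists_aeval_eq_zero (AlgebraicClosure F) P hirr.degree_pos.ne'
  have hmin : P = minpoly F z := minpoly.eq_of_irreducible_of_monic hirr hz hP
  have hfix : z ∈ frobFixed F (AlgebraicClosure F) P.natDegree :=
    mem_frobFixed_iff_dvd.2 ⟨hirr.natDegree_pos.ne', by rw [← hmin]⟩
  have hmap := map_minpoly_pow_eq_prod hfix
  rw [← hmin, Nat.div_self hirr.natDegree_pos, pow_one] at hmap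
  let ι : AdjoinRoot P →ₐ[F] AlgebraicClosure F :=
    AdjoinRoot.liftAlgHom P (Algebra.ofId F _) z hz
  have hι : ι (AdjoinRoot.mk P η) = aeval z η := AdjoinRoot.liftAlgHom_mk _ _ _ _ _
  have hfin : Module.Finite F (AdjoinRoot P) := hP.finite_adjoinRoot
  have hfin' : Finite (AdjoinRoot P) := Module.finite_of_finite F
  have hcard : Nat.card (AdjoinRoot P) = Nat.card F ^ P.natDegree := by
    rw [Module.natCard_eq_pow_finrank (K := F), (AdjoinRoot.powerBasis hirr.ne_zero).finrank,
      AdjoinRoot.powerBasis_dim]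
  apply (algebraMap F (AlgebraicClosure F)).injective
  refine (algebraMap_resultant_of_monic _ hP η).trans ?_
  rw [← ι.commutes, FiniteField.algebraMap_norm_eq_pow, map_pow, hι, hcard,
    ← Nat.geomSum_eq (Finite.one_lt_card (α := F)), ← Finset.prod_pow_eq_pow_sum, hmap]
  have hroots : (∏ i ∈ Finset.range P.natDegree, (X - C (z ^ Nat.card F ^ i))).roots =
      (Finset.range P.natDegree).val.map fun i => z ^ Nat.card F ^ i := by
    rw [← roots_multiset_prod_X_sub_C ((Finset.range P.natDegree).val.map fun i =>
      z ^ Nat.card F ^ i), Multiset.map_map]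
    rfl
  rw [hroots, Multiset.map_map]
  refine Finset.prod_congr rfl fun i _ => ?_
  obtain ⟨φ, hφ⟩ := exists_algHom_eq_pow_card (F := F) (L := AlgebraicClosure F) i
  simp only [Function.comp, eval_map_algebraMap]
  rw [← hφ, ← hφ, aeval_algHom_apply]

theorem exists_isCoprime_resultantChar_ne_one {χ : MulChar F ℂ} (hχ : χ ≠ 1) {A B₁ P : F[X]}
    (hA : A.Monic) (hB₁ : B₁.Monic) (hP : P.Monic) (hirr : Irreducible P)
    (hcop : IsCoprime P (A * B₁)) :
    ∃ h, IsCoprime (A * (P * B₁)) h ∧ resultantChar χ hA (hP.mul hB₁) h ≠ 1 := by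
  have : Fact (Irreducible P) := ⟨hirr⟩
  have hfin : Module.Finite F (AdjoinRoot P) := hP.finite_adjoinRoot
  have hfin' : Finite (AdjoinRoot P) := Module.finite_of_finite F
  obtain ⟨c, hc⟩ := MulChar.ne_one_iff.1 hχ
  obtain ⟨y, hy⟩ := FiniteField.norm_surjective F (AdjoinRoot P) ((c : F)⁻¹)
  obtain ⟨η, rfl⟩ := AdjoinRoot.mk_surjective y
  obtain ⟨a, b, hab⟩ := hcop
  have hPη : IsCoprime P η := by
    rw [hirr.coprime_iff_not_dvd, ← AdjoinRoot.mk_eq_zero]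
    intro h0
    rw [h0, Algebra.norm_zero] at hy
    exact inv_ne_zero c.ne_zero hy.symm
  set h := 1 + A * B₁ * b * (η - 1) with hh
  have h1 : h = η + P * (-(a * (η - 1))) := by
    rw [hh]; linear_combination (η - 1) * hab
  refine ⟨h, ?_, ?_⟩
  · refine IsCoprime.mul_left ?_ (IsCoprime.mul_left ?_ ?_)
    · exact ⟨-(B₁ * b * (η - 1)), 1, by rw [hh]; ring⟩
    · rw [h1]
      exact IsCoprime.add_mul_left_right hPη _
    · exact ⟨-(A * b * (η - 1)), 1, by rw [hh]; ring⟩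
  · have e1 : resultantHom A hA h = 1 := by
      rw [resultantHom_congr hA (g' := 1) ⟨B₁ * b * (η - 1), by rw [hh]; ring⟩, map_one]
    have e2 : resultantHom B₁ hB₁ h = 1 := by
      rw [resultantHom_congr hB₁ (g' := 1) ⟨A * b * (η - 1), by rw [hh]; ring⟩, map_one]
    have e3 : resultantHom P hP h = (c : F)⁻¹ := by
      rw [resultantHom_congr hP (g' := η) ⟨-(a * (η - 1)), by rw [h1]; ring⟩,
        resultantHom_eq_norm_mk, hy]
    change χ _ ≠ 1
    rwa [e1, resultantHom_mul_left hP hB₁, e2, e3, mul_one, one_mul, inv_inv]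

theorem card_frobFixed (L : Type*) [Field L] [Algebra F L] [IsAlgClosed L] {r : ℕ} (hr : r ≠ 0) :
    (frobFixed F L r).card = Nat.card F ^ r := by
  classical
  have := Fintype.ofFinite F
  obtain ⟨p, hp⟩ := CharP.exists F
  obtain ⟨n, hprime, hcard⟩ := FiniteField.card F p
  have : CharP L p := charP_of_injective_algebraMap (algebraMap F L).injective p
  have hsep : (X ^ Nat.card F ^ r - X : L[X]).Separable := by
    refine galois_poly_separable p _ (dvd_pow ?_ hr)
    rw [Nat.card_eq_fintype_card, hcard]
    exact dvd_pow_self p n.ne_zero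
  rw [frobFixed, Multiset.toFinset_card_of_nodup (nodup_roots hsep),
    splits_iff_card_roots.1 (IsAlgClosed.splits _),
    FiniteField.X_pow_card_pow_sub_X_natDegree_eq L hr Finite.one_lt_card]

theorem mulChar_norm_le_one (χ : MulChar F ℂ) (x : F) : ‖χ x‖ ≤ 1 := by
  by_cases hx : IsUnit x
  · obtain ⟨u, rfl⟩ := hx
    have hpow : χ u ^ Nat.card Fˣ = 1 := by
      rw [← map_pow, ← Units.val_pow_eq_pow_val, pow_card_eq_one', Units.val_one, map_one]
    exact (Complex.norm_eq_one_of_pow_eq_one hpow Nat.card_pos.ne').le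
  · rw [χ.map_nonunit hx, norm_zero]
    exact zero_le_one

theorem norm_sum_mulChar_mul_le [Fintype F] {χ : MulChar F ℂ} (hχ : χ ≠ 1) (e : F → ℝ)
    {a b : ℝ} (h0 : e 0 = 0) (he : ∀ c, c ≠ 0 → e c ≤ a)
    (hsum : ∑ c, e c = (Fintype.card F - 1) * a - b) : ‖∑ c, χ c * (e c : ℂ)‖ ≤ b := by
  classical
  have h1 : ∑ c, χ c * (e c : ℂ) = - ∑ c, χ c * ((if c = 0 then 0 else a - e c : ℝ) : ℂ) := by
    have h2 : ∑ c, χ c * (a : ℂ) = 0 := by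
      rw [← Finset.sum_mul, MulChar.sum_eq_zero_of_ne_one hχ, zero_mul]
    rw [← sub_eq_zero, sub_neg_eq_add, ← Finset.sum_add_distrib, ← h2]
    refine Finset.sum_congr rfl fun c _ => ?_
    split_ifs with hc
    · simp [hc, h0, MulChar.map_zero]
    · push_cast; ring
  rw [h1, norm_neg]
  refine (norm_sum_le _ _).trans ?_
  have h3 : ∀ c ∈ Finset.univ, ‖χ c * ((if c = 0 then 0 else a - e c : ℝ) : ℂ)‖ ≤
      if c = 0 then 0 else a - e c := fun c _ => by
    have hnn : 0 ≤ (if c = 0 then 0 else a - e c : ℝ) := by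
      split_ifs with hc
      · exact le_rfl
      · exact sub_nonneg.2 (he c hc)
    rw [norm_mul, Complex.norm_real, Real.norm_of_nonneg hnn]
    exact mul_le_of_le_one_left hnn (mulChar_norm_le_one χ c)
  refine (Finset.sum_le_sum h3).trans (le_of_eq ?_)
  have h4 : ∀ c : F, (if c = 0 then 0 else a - e c) = (a - e c) - if c = 0 then a else 0 :=
    fun c => by
      split_ifs with hc
      · simp [hc, h0]
      · simp
  rw [Finset.sum_congr rfl fun c _ => h4 c, Finset.sum_sub_distrib, Finset.sum_sub_distrib,
    hsum]
  simp
  ring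

theorem algebraMap_resultantHom_minpoly_pow (L : Type*) [Field L] [Algebra F L] [IsAlgClosed L]
    [Algebra.IsAlgebraic F L] {A : F[X]} (hA : A.Monic) {r : ℕ} {z : L}
    (hz : z ∈ frobFixed F L r) :
    algebraMap F L (resultantHom A hA (minpoly F z ^ (r / (minpoly F z).natDegree))) =
      (-1) ^ (A.natDegree * r) *
        (A.map (algebraMap F L)).eval z ^ ∑ i ∈ Finset.range r, Nat.card F ^ i := by
  rw [algebraMap_resultantHom_of_map_eq_prod L hA (map_minpoly_pow_eq_prod hz),
    ← Finset.prod_pow_eq_pow_sum]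
  congr 1
  refine Finset.prod_congr rfl fun i _ => ?_
  obtain ⟨φ, hφ⟩ := exists_algHom_eq_pow_card (F := F) (L := L) i
  rw [← hφ, ← hφ, eval_map_algebraMap, eval_map_algebraMap, aeval_algHom_apply]

end Weil

section WeilBound

open Polynomial

variable {F : Type*} [Field F] [Fintype F] {L : Type*} [Field L] [Algebra F L]
  [Algebra.IsAlgebraic F L] [IsAlgClosed L]

theorem norm_logDerivCoeff_two_mul_le (hF : 3 ≤ Fintype.card F) {χ : MulChar F ℂ} (hχ : χ ≠ 1)
    {A B : F[X]} (hA : A.Monic) (hB : B.Monic) (hsep : B.Separable) {β : L}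
    (hβB : aeval β B = 0) (hβA : aeval β A ≠ 0) {D : ℕ} (hAD : A.natDegree ≤ D)
    (hBD : B.natDegree ≤ D) (r : ℕ) :
    ‖logDerivCoeff L (resultantChar χ hA hB) (2 * r)‖ ≤
      ((Fintype.card F - 1 : ℕ) * (4 * D + 3) + 2 * D : ℕ) * √(Fintype.card F) ^ (2 * r) := by
  classical
  rcases eq_or_ne r 0 with rfl | hr
  · have : frobFixed F L (2 * 0) = ∅ :=
      Finset.eq_empty_of_forall_notMem fun z hz => (mem_frobFixed.1 hz).1 rfl
    rw [logDerivCoeff, this, Finset.sum_empty, norm_zero]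
    positivity
  obtain ⟨p, hp⟩ := CharP.exists F
  obtain ⟨m, hprime, hcard⟩ := FiniteField.card F p
  have : Fact p.Prime := ⟨hprime⟩
  have : CharP L p := charP_of_injective_algebraMap (algebraMap F L).injective p
  set M := Fintype.card F - 1 with hM
  set s := Fintype.card F ^ r with hs
  have hdvd : M ∣ s - 1 := by simpa using Nat.sub_dvd_pow_sub_pow (Fintype.card F) 1 r
  obtain ⟨t, ht⟩ := hdvd
  have hs2 : Fintype.card F ≤ s := Nat.le_self_pow hr _
  have hst : s = M * t + 1 := by omega
  have ht1 : 1 ≤ t := by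
    rcases Nat.eq_zero_or_pos t with rfl | h
    · omega
    · exact h
  set E := (s + 1) * t with hE
  have hE0 : E ≠ 0 := by positivity
  have hsum : ∑ i ∈ Finset.range (2 * r), Nat.card F ^ i = E := by
    rw [Nat.card_eq_fintype_card]
    exact sum_pow_eq_of_pow_eq (by omega) hs hst
  set A' := A.map (algebraMap F L) with hA'
  set B' := B.map (algebraMap F L) with hB'
  have hA'm : A'.Monic := hA.map _
  have hB'm : B'.Monic := hB.map _
  obtain ⟨B₁, hB₁⟩ : X - C β ∣ B' := by
    rw [dvd_iff_isRoot, IsRoot, eval_map_algebraMap, hβB]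
  have hB₁β : B₁.eval β ≠ 0 := fun h => by
    obtain ⟨u, hu⟩ := dvd_iff_isRoot.2 h
    have hsq : Squarefree B' := (hsep.map (f := algebraMap F L)).squarefree
    exact not_isUnit_X_sub_C β (hsq (X - C β) ⟨u, by rw [hB₁, hu, mul_assoc]⟩)
  set T : L → F[X] := fun z => minpoly F z ^ (2 * r / (minpoly F z).natDegree)
  set ρ : L → F := fun z => resultantHom A hA (T z) * (resultantHom B hB (T z))⁻¹ with hρdef
  have hρ : ∀ z ∈ frobFixed F L (2 * r),
      algebraMap F L (ρ z) = A'.eval z ^ E * (B'.eval z ^ E)⁻¹ := fun z hz => by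
    have heven : ∀ d, (-1 : L) ^ (d * (2 * r)) = 1 := fun d => by
      rw [show d * (2 * r) = 2 * (d * r) by ring, pow_mul]; simp
    rw [hρdef]
    simp only [map_mul, map_inv₀]
    rw [algebraMap_resultantHom_minpoly_pow L hA hz, algebraMap_resultantHom_minpoly_pow L hB hz,
      hsum, heven, heven, one_mul, one_mul]
  set N : F → Finset L := fun c => (frobFixed F L (2 * r)).filter fun z => ρ z = c with hN
  have hcardN : ∑ c, (N c).card = s * s := by
    rw [← Finset.card_eq_sum_card_fiberwise (f := ρ)
        fun _ _ => Finset.mem_coe.2 (Finset.mem_univ _),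
      card_frobFixed L (by omega), Nat.card_eq_fintype_card, hs]
    ring
  have hstep : ∀ c, c ≠ 0 → M * (N c).card ≤ s * s + M * (4 * D + 3) * s := fun c hc => by
    refine stepanov_bound (L := L) p (m * r) (t := t) (by rw [hs, hcard, pow_mul]) hst (by omega)
      ht1 (A := A') (B := B') (B₁ := B₁) (β := β) (by rwa [natDegree_map])
      (by rwa [natDegree_map]) (by rwa [eval_map_algebraMap]) hB₁ hB₁β (algebraMap F L c) _
      fun z hz => ?_
    obtain ⟨hz, hzc⟩ := Finset.mem_filter.1 hz
    have h1 := hρ z hz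
    rw [hzc] at h1
    have hc' : algebraMap F L c ≠ 0 := by simpa using hc
    have hAz : A'.eval z ≠ 0 := fun h => hc' (by rw [h1, h, zero_pow hE0, zero_mul])
    have hBz : B'.eval z ≠ 0 := fun h => hc' (by rw [h1, h, zero_pow hE0, inv_zero, mul_zero])
    refine ⟨?_, hAz, hBz, ?_⟩
    · rw [hs, ← pow_add, ← two_mul, ← Nat.card_eq_fintype_card]
      exact (mem_frobFixed.1 hz).2
    · rw [h1, inv_mul_cancel_right₀ (pow_ne_zero _ hBz)]
  have hN0 : (N 0).card ≤ 2 * D := by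
    have hsub : N 0 ⊆ (A' * B').roots.toFinset := fun z hz => by
      obtain ⟨hz, hzc⟩ := Finset.mem_filter.1 hz
      have h1 := hρ z hz
      rw [hzc, map_zero, eq_comm, mul_eq_zero, inv_eq_zero, pow_eq_zero_iff hE0,
        pow_eq_zero_iff hE0] at h1
      rw [Multiset.mem_toFinset, mem_roots (mul_ne_zero hA'm.ne_zero hB'm.ne_zero), IsRoot,
        eval_mul, mul_eq_zero]
      exact h1
    calc (N 0).card ≤ (A' * B').natDegree := (Finset.card_le_card hsub).trans
          ((Multiset.toFinset_card_le _).trans (card_roots' _))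
      _ = A.natDegree + B.natDegree := by
          rw [hA'm.natDegree_mul hB'm, natDegree_map, natDegree_map]
      _ ≤ 2 * D := by omega
  have hlog : logDerivCoeff L (resultantChar χ hA hB) (2 * r) =
      ∑ c, χ c * ((N c).card : ℂ) := by
    rw [logDerivCoeff, ← Finset.sum_fiberwise _ ρ]
    refine Finset.sum_congr rfl fun c _ => ?_
    rw [mul_comm (χ c), ← nsmul_eq_mul, ← Finset.sum_const]
    refine Finset.sum_congr rfl fun z hz => ?_
    rw [← (Finset.mem_filter.1 hz).2]
    rfl
  set K := M * (4 * D + 3) with hK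
  have hMR : (Fintype.card F : ℝ) - 1 = M := by
    rw [hM, Nat.cast_sub (by omega), Nat.cast_one]
  set e : F → ℝ := fun c => if c = 0 then 0 else M * (N c).card with he
  have hesum : ∑ c, e c = (Fintype.card F - 1) * (s * s + K * s : ℝ) -
      (M * (K * s) + M * (N 0).card : ℝ) := by
    have h1 : ∀ c, e c = (M : ℝ) * (N c).card - if c = 0 then (M : ℝ) * (N 0).card else 0 :=
      fun c => by
        rw [he]
        dsimp only
        split_ifs with hc
        · rw [hc, sub_self]
        · rw [sub_zero]
    have h2 : (∑ c, ((N c).card : ℝ)) = s * s := by exact_mod_cast hcardN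
    rw [Finset.sum_congr rfl fun c _ => h1 c, Finset.sum_sub_distrib, ← Finset.mul_sum, h2, hMR,
      Finset.sum_ite_eq' Finset.univ (0 : F), if_pos (Finset.mem_univ _)]
    ring
  have hmain := norm_sum_mulChar_mul_le hχ e (if_pos rfl) (fun c hc => by
    rw [he]
    dsimp only
    rw [if_neg hc]
    exact_mod_cast hstep c hc) hesum
  have hMS : ∑ c, χ c * (e c : ℂ) = M * logDerivCoeff L (resultantChar χ hA hB) (2 * r) := by
    rw [hlog, Finset.mul_sum]
    refine Finset.sum_congr rfl fun c _ => ?_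
    rw [he]
    dsimp only
    split_ifs with hc
    · rw [hc, MulChar.map_zero]; simp
    · push_cast; ring
  have hM0 : (0 : ℝ) < M := by exact_mod_cast (by omega : 0 < M)
  rw [hMS, norm_mul, Complex.norm_natCast, ← mul_add] at hmain
  have hmain' := le_of_mul_le_mul_left hmain hM0
  have hsqrt : √(Fintype.card F : ℝ) ^ (2 * r) = s := by
    rw [pow_mul, Real.sq_sqrt (by positivity), hs]; push_cast; rfl
  rw [hsqrt]
  refine hmain'.trans ?_
  have h3 : K * s + (N 0).card ≤ (K + 2 * D) * s := by
    have : 2 * D ≤ 2 * D * s := Nat.le_mul_of_pos_right _ (by omega)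
    nlinarith
  exact_mod_cast h3

/-- The Weil bound for a multiplicative character sum over the values of a rational function. -/
theorem norm_sum_mulChar_div_le (hF : 3 ≤ Fintype.card F) {χ : MulChar F ℂ} (hχ : χ ≠ 1)
    {A B : F[X]} (hA : A.Monic) (hB : B.Monic) (hsep : B.Separable) {β : L}
    (hβB : aeval β B = 0) (hβA : aeval β A ≠ 0)
    (hsign : (-1 : F) ^ A.natDegree = (-1) ^ B.natDegree) :
    ‖∑ x : F, χ (A.eval x * (B.eval x)⁻¹)‖ ≤
      (A.natDegree + B.natDegree : ℕ) * √(Fintype.card F) := by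
  classical
  have hintegral : IsIntegral F β := Algebra.IsIntegral.isIntegral β
  obtain ⟨B₁, hB₁⟩ := minpoly.dvd F β hβB
  have hP := minpoly.monic hintegral
  have hirr := minpoly.irreducible hintegral
  have hB₁m : B₁.Monic := hP.of_mul_monic_left (hB₁ ▸ hB)
  have hcop : IsCoprime (minpoly F β) (A * B₁) := by
    rw [hirr.coprime_iff_not_dvd]
    intro h
    rcases hirr.prime.dvd_or_dvd h with h | ⟨u, hu⟩
    · exact hβA ((minpoly.dvd_iff).1 h)
    · exact hirr.not_isUnit (hsep.squarefree (minpoly F β) ⟨u, by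
        rw [hB₁, mul_assoc, ← hu]⟩)
  obtain ⟨h, hcoph, hψh⟩ := exists_isCoprime_resultantChar_ne_one hχ hA hB₁m hP hirr hcop
  set ψ := resultantChar χ hA hB with hψ
  have hψh' : ψ h ≠ 1 := by
    subst hB₁
    exact hψh
  rw [← hB₁] at hcoph
  set D := A.natDegree + B.natDegree with hD
  have hzero : ∀ k, D ≤ k → ∑ g ∈ monicsOfNatDegree F k, ψ g = 0 := fun k hk => by
    refine sum_monics_eq_zero_of_periodic ψ (hA.mul hB) (fun g g' hg => ?_) hcoph hψh'
      (by rwa [hA.natDegree_mul hB])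
    change χ _ = χ _
    rw [resultantHom_congr hA ((dvd_mul_right A B).trans hg),
      resultantHom_congr hB ((dvd_mul_left B A).trans hg)]
  set P : ℂ[X] := ∑ k ∈ Finset.range D, C (∑ g ∈ monicsOfNatDegree F k, ψ g) * X ^ k with hPdef
  have hcoeff : ∀ k, P.coeff k = ∑ g ∈ monicsOfNatDegree F k, ψ g := fun k => by
    rw [hPdef, finsetSum_coeff]
    simp only [coeff_C_mul_X_pow]
    rw [Finset.sum_ite_eq]
    split_ifs with hk
    · rfl
    · exact (hzero k (by simpa using hk)).symm
  have hdeg : P.natDegree ≤ D := natDegree_sum_le_of_forall_le _ _ fun k hk =>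
    (natDegree_C_mul_X_pow_le _ _).trans (Finset.mem_range.1 hk).le
  have h0 : monicsOfNatDegree F 0 = {1} := by
    ext g
    rw [mem_monicsOfNatDegree, Finset.mem_singleton]
    exact ⟨fun hg => hg.1.natDegree_eq_zero.1 hg.2, fun hg => by simp [hg]⟩
  have hbound := norm_coeff_one_le_of_even_logDeriv (P := P)
    (by rw [hcoeff, h0, Finset.sum_singleton, map_one])
    (S := logDerivCoeff L ψ) (fun k => by
      rw [hcoeff, natCast_mul_sum_monics (L := L) ψ k]
      exact Finset.sum_congr rfl fun x _ => by rw [hcoeff])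
    (Real.sqrt_nonneg (Fintype.card F))
    (norm_logDerivCoeff_two_mul_le hF hχ hA hB hsep hβB hβA (D := D) (by omega) (by omega))
  have hone : P.coeff 1 = ∑ x : F, χ (A.eval x * (B.eval x)⁻¹) := by
    rw [hcoeff]
    refine (Finset.sum_bij (fun x _ => X - C x) (fun x _ => ?_) (fun x _ y _ hxy => ?_)
      (fun g hg => ?_) fun x _ => ?_).symm
    · exact mem_monicsOfNatDegree.2 ⟨monic_X_sub_C x, natDegree_X_sub_C x⟩
    · exact C_injective (sub_right_injective hxy)
    · obtain ⟨hg, hg1⟩ := mem_monicsOfNatDegree.1 hg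
      refine ⟨-g.coeff 0, Finset.mem_univ _, ?_⟩
      rw [hg.eq_X_add_C hg1]
      simp
    · have hres : ∀ {G : F[X]} (hG : G.Monic), resultantHom G hG (X - C x) =
          (-1) ^ G.natDegree * G.eval x := fun {G} hG => by
        apply (algebraMap F (AlgebraicClosure F)).injective
        rw [algebraMap_resultantHom_of_map_eq_prod (AlgebraicClosure F) hG (r := 1)
          (z := fun _ => algebraMap F _ x) (by simp)]
        simp [eval_map_algebraMap, aeval_algebraMap_apply]
      change χ _ = χ _
      rw [hres hA, hres hB, hsign, mul_inv, mul_mul_mul_comm,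
        mul_inv_cancel₀ (pow_ne_zero _ (neg_ne_zero.2 one_ne_zero)), one_mul]
  rw [← hone]
  refine hbound.trans ?_
  gcongr

end WeilBound

section FrobeniusRatio

open Polynomial

variable {F : Type*} [Field F] [Fintype F]

theorem exists_pow_eq_of_mulChar_eq_one {χ : MulChar F ℂ} {m : ℕ}
    (hχ : orderOf χ = Nat.gcd m (Fintype.card F - 1)) {u : F} (hu : χ u = 1) :
    ∃ w : F, w ≠ 0 ∧ w ^ m = u := by
  have hunit : IsUnit u := by
    by_contra h
    rw [χ.map_nonunit h] at hu
    exact zero_ne_one hu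
  obtain ⟨u, rfl⟩ := hunit
  obtain ⟨g, hg⟩ := IsCyclic.exists_generator (α := Fˣ)
  obtain ⟨j, rfl⟩ := Subgroup.mem_zpowers_iff.1 (hg u)
  have hker : ∀ i : ℤ, MulChar.equivToUnitHom χ g ^ i = 1 → (orderOf χ : ℤ) ∣ i := fun i hi => by
    rw [orderOf_dvd_iff_zpow_eq_one]
    apply (MulChar.mulEquivToUnitHom (R := F) (R' := ℂ)).injective
    rw [map_zpow, map_one]
    ext x
    obtain ⟨l, rfl⟩ := Subgroup.mem_zpowers_iff.1 (hg x)
    have : (MulChar.equivToUnitHom χ ^ i) (g ^ l) = 1 := by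
      rw [map_zpow, MonoidHom.zpow_apply, hi, one_zpow]
    exact congrArg Units.val this
  obtain ⟨d, hd⟩ := hker j (by
    rw [← map_zpow]
    ext
    rw [MulChar.coe_equivToUnitHom, hu, Units.val_one])
  have hpow : g ^ (orderOf χ : ℤ) = (g ^ (m.gcdA (Fintype.card F - 1))) ^ m := by
    have h1 : g ^ (Fintype.card F - 1) = 1 := by
      classical
      rw [← Fintype.card_units]
      exact pow_card_eq_one
    rw [hχ, Nat.gcd_eq_gcd_ab, zpow_add, zpow_mul g ((Fintype.card F - 1 : ℕ) : ℤ),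
      zpow_natCast, h1,
      one_zpow, mul_one, mul_comm, zpow_mul, zpow_natCast]
  refine ⟨((g ^ (m.gcdA (Fintype.card F - 1))) ^ d : Fˣ), Units.ne_zero _, ?_⟩
  rw [hd, zpow_mul, hpow, ← Units.val_pow_eq_pow_val, ← zpow_natCast, ← zpow_natCast, zpow_comm]

theorem exists_mulChar_eq_one_of_bound [DecidableEq F] {χ : MulChar F ℂ} {f : F → F} {c : ℝ} {d : ℕ}
    (hd : (Finset.univ.filter fun x => f x = 0).card ≤ d)
    (hbound : ∀ i, 0 < i → i < orderOf χ → ‖∑ x, (χ ^ i) (f x)‖ ≤ c)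
    (hlt : d + ((orderOf χ - 1 : ℕ) : ℝ) * c < Fintype.card F) :
    ∃ x, χ (f x) = 1 := by
  by_contra! hne
  have hk : 0 < orderOf χ := χ.orderOf_pos
  have hzero : ∀ x, ∑ i ∈ Finset.range (orderOf χ), (χ ^ i) (f x) = 0 := fun x => by
    rcases eq_or_ne (f x) 0 with h0 | h0
    · exact Finset.sum_eq_zero fun i _ => by rw [h0, MulChar.map_zero]
    · have hu : IsUnit (f x) := h0.isUnit
      obtain ⟨u, hu⟩ := hu
      rw [← hu]
      simp only [MulChar.pow_apply_coe]
      have h1 := mul_neg_geom_sum (χ u) (orderOf χ)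
      rw [← MulChar.pow_apply_coe, pow_orderOf_eq_one, MulChar.one_apply_coe, sub_self,
        mul_eq_zero] at h1
      refine h1.resolve_left fun h => hne x ?_
      rw [← hu]
      exact (sub_eq_zero.1 h).symm
  have hsum : ∑ i ∈ Finset.range (orderOf χ), ∑ x, (χ ^ i) (f x) = 0 := by
    rw [Finset.sum_comm]
    exact Finset.sum_eq_zero fun x _ => hzero x
  obtain ⟨k, hkeq⟩ := Nat.exists_eq_add_of_lt hk
  rw [zero_add] at hkeq
  rw [hkeq, Finset.sum_range_succ'] at hsum
  have hfirst : ∑ x, (χ ^ 0) (f x) =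
      ((Finset.univ.filter fun x => f x ≠ 0).card : ℂ) := by
    rw [← Finset.sum_boole]
    refine Finset.sum_congr rfl fun x _ => ?_
    rw [pow_zero]
    split_ifs with h
    · exact MulChar.one_apply h.isUnit
    · rw [not_not.1 h, MulChar.map_zero]
  have hcard : (Finset.univ.filter fun x => f x = 0).card +
      (Finset.univ.filter fun x => f x ≠ 0).card = Fintype.card F :=
    Finset.card_filter_add_card_filter_not _
  have hle : ((Finset.univ.filter fun x => f x ≠ 0).card : ℝ) ≤ k * c := by
    rw [hfirst, add_comm, ← eq_neg_iff_add_eq_zero] at hsum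
    have h2 := congrArg norm hsum
    rw [Complex.norm_natCast, norm_neg] at h2
    rw [h2]
    refine (norm_sum_le_of_le (f := fun i => ∑ x, (χ ^ (i + 1)) (f x)) (n := fun _ => c) _
      fun i hi => hbound (i + 1) i.succ_pos ?_).trans ?_
    · rw [hkeq]
      exact Nat.succ_lt_succ (Finset.mem_range.1 hi)
    · rw [Finset.sum_const, Finset.card_range, nsmul_eq_mul]
  rw [hkeq, Nat.add_sub_cancel] at hlt
  have h3 : (Fintype.card F : ℝ) ≤ d + (Finset.univ.filter fun x => f x ≠ 0).card := by
    rw [← hcard]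
    push_cast
    gcongr
  linarith

theorem exists_frobenius_ratio {q n a b : ℕ} (hq : 2 ≤ q) (hF : Fintype.card F = q ^ n)
    (ha : 0 < a) (hab : a < b) (hb : 4 * b ≤ n) {v : F} (hv : v ≠ 0) :
    ∃ l w : F, w ≠ 0 ∧ l ^ q ^ a ≠ l ∧ l ^ q ^ b ≠ l ∧
      w ^ (q ^ (b - a) - 1) * (l ^ q ^ b - l) = v * (l ^ q ^ a - l) := by
  classical
  have hqa : 1 < q ^ a := Nat.one_lt_pow ha.ne' (by omega)
  have hqb : 1 < q ^ b := Nat.one_lt_pow (by omega) (by omega)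
  have hqab : q ^ a < q ^ b := Nat.pow_lt_pow_right (by omega) hab
  have hq0 : (q : F) = 0 := by
    have h := FiniteField.cast_card_eq_zero F
    rw [hF, Nat.cast_pow] at h
    exact eq_zero_of_pow_eq_zero h
  have hmonic : ∀ {N : ℕ}, 1 < N → (X ^ N - X : F[X]).Monic := fun hN =>
    monic_X_pow_sub (by rw [degree_X]; exact_mod_cast hN)
  have hnat : ∀ {N : ℕ}, 1 < N → (X ^ N - X : F[X]).natDegree = N := fun hN =>
    FiniteField.X_pow_card_sub_X_natDegree_eq F hN
  have hsep : (X ^ q ^ b - X : F[X]).Separable := by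
    refine galois_poly_separable (ringChar F) _ ?_
    exact ((ringChar.spec F q).1 hq0).trans (dvd_pow_self q (by omega))
  obtain ⟨β, hβB, hβA⟩ : ∃ β : AlgebraicClosure F, aeval β (X ^ q ^ b - X : F[X]) = 0 ∧
      aeval β (X ^ q ^ a - X : F[X]) ≠ 0 := by
    by_contra! hcon
    set A' := (X ^ q ^ a - X : F[X]).map (algebraMap F (AlgebraicClosure F)) with hA'
    set B' := (X ^ q ^ b - X : F[X]).map (algebraMap F (AlgebraicClosure F)) with hB'
    have hsub : B'.roots.toFinset ⊆ A'.roots.toFinset := fun z hz => by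
      rw [Multiset.mem_toFinset, mem_roots ((hmonic hqb).map _).ne_zero, IsRoot,
        eval_map_algebraMap] at hz
      rw [Multiset.mem_toFinset, mem_roots ((hmonic hqa).map _).ne_zero, IsRoot,
        eval_map_algebraMap]
      exact hcon z hz
    have h1 : B'.roots.toFinset.card = q ^ b := by
      rw [Multiset.toFinset_card_of_nodup (nodup_roots hsep.map),
        splits_iff_card_roots.1 (IsAlgClosed.splits _), natDegree_map, hnat hqb]
    have h2 : A'.roots.toFinset.card ≤ q ^ a := by
      refine (Multiset.toFinset_card_le _).trans ((card_roots' _).trans ?_)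
      rw [natDegree_map, hnat hqa]
    have := Finset.card_le_card hsub
    omega
  have hsign : (-1 : F) ^ (X ^ q ^ a - X : F[X]).natDegree =
      (-1) ^ (X ^ q ^ b - X : F[X]).natDegree := by
    rw [hnat hqa, hnat hqb]
    rcases Nat.even_or_odd q with h | h
    · rw [(h.pow_of_ne_zero ha.ne').neg_one_pow, (h.pow_of_ne_zero (by omega)).neg_one_pow]
    · rw [h.pow.neg_one_pow, h.pow.neg_one_pow]
  have hn : q ^ (2 * b) * q ^ (2 * b) ≤ Fintype.card F := by
    rw [hF, ← pow_add]
    exact Nat.pow_le_pow_right (by omega) (by omega)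
  have h2b : q ^ b ≤ q ^ (2 * b) := Nat.pow_le_pow_right (by omega) (by omega)
  have hcard3 : 3 ≤ Fintype.card F := by nlinarith
  set k := Nat.gcd (q ^ (b - a) - 1) (Fintype.card F - 1) with hk
  have hk0 : 0 < k := Nat.gcd_pos_of_pos_right _ (by omega)
  have hσ : 1 < q ^ (b - a) := Nat.one_lt_pow (by omega) (by omega)
  have hkσ : k ≤ q ^ (b - a) - 1 := Nat.gcd_le_left _ (by omega)
  obtain ⟨χ, hχ⟩ := MulChar.exists_mulChar_orderOf F (Nat.gcd_dvd_right _ _ : k ∣ _)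
    (Complex.isPrimitiveRoot_exp k hk0.ne')
  set f : F → F := fun x => v * ((X ^ q ^ a - X : F[X]).eval x * ((X ^ q ^ b - X : F[X]).eval x)⁻¹)
    with hf
  obtain ⟨l, hl⟩ := exists_mulChar_eq_one_of_bound (χ := χ) (f := f)
    (c := (q ^ a + q ^ b : ℕ) * √(Fintype.card F)) (d := q ^ a + q ^ b) (by
      have hsub : (Finset.univ.filter fun x => f x = 0) ⊆
          ((X ^ q ^ a - X) * (X ^ q ^ b - X) : F[X]).roots.toFinset := fun x hx => by
        have hx := (Finset.mem_filter.1 hx).2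
        rw [hf] at hx
        simp only [mul_eq_zero, hv, false_or, inv_eq_zero] at hx
        rw [Multiset.mem_toFinset, mem_roots (mul_ne_zero (hmonic hqa).ne_zero
          (hmonic hqb).ne_zero), IsRoot, eval_mul, mul_eq_zero]
        exact hx
      refine (Finset.card_le_card hsub).trans ((Multiset.toFinset_card_le _).trans
        ((card_roots' _).trans ?_))
      rw [(hmonic hqa).natDegree_mul (hmonic hqb), hnat hqa, hnat hqb]) (fun i hi0 hi => by
      have hne : χ ^ i ≠ 1 := pow_ne_one_of_lt_orderOf hi0.ne' hi
      have h := norm_sum_mulChar_div_le hcard3 hne (hmonic hqa) (hmonic hqb) hsep hβB hβA hsign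
      rw [hnat hqa, hnat hqb] at h
      rw [hf]
      simp only [map_mul (χ ^ i) v]
      rw [← Finset.mul_sum, norm_mul]
      exact (mul_le_of_le_one_left (norm_nonneg _) (mulChar_norm_le_one _ _)).trans h) (by
      rw [hχ]
      set s := √(Fintype.card F : ℝ) with hs
      have hss : s * s = Fintype.card F := Real.mul_self_sqrt (by positivity)
      have hs1 : (q : ℝ) ^ (2 * b) ≤ s := Real.le_sqrt_of_sq_le (by rw [sq]; exact_mod_cast hn)
      have hkR : ((k - 1 : ℕ) : ℝ) ≤ (q : ℝ) ^ (b - a) - 2 := by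
        have : k - 1 + 2 ≤ q ^ (b - a) := by omega
        have : ((k - 1 : ℕ) : ℝ) + 2 ≤ (q : ℝ) ^ (b - a) := by exact_mod_cast this
        linarith
      have hqa' : (1 : ℝ) < (q : ℝ) ^ a := by exact_mod_cast hqa
      have hqb' : (1 : ℝ) < (q : ℝ) ^ b := by exact_mod_cast hqb
      have e1 : (q : ℝ) ^ (b - a) * (q : ℝ) ^ a = (q : ℝ) ^ b := by
        rw [← pow_add, Nat.sub_add_cancel hab.le]
      have e2 : (q : ℝ) ^ (b - a) * (q : ℝ) ^ b ≤ s := by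
        refine le_trans ?_ hs1
        rw [← pow_add]
        exact pow_le_pow_right₀ (by exact_mod_cast (by omega : 1 ≤ q)) (by omega)
      have e3 : 1 < s := by
        refine lt_of_lt_of_le ?_ hs1
        exact_mod_cast Nat.one_lt_pow (by omega) (by omega)
      rw [← hss]
      push_cast
      have e4 : ((k - 1 : ℕ) : ℝ) * ((q : ℝ) ^ a + (q : ℝ) ^ b) ≤
          s - (q : ℝ) ^ b - 2 * (q : ℝ) ^ a := by
        calc ((k - 1 : ℕ) : ℝ) * ((q : ℝ) ^ a + (q : ℝ) ^ b)
            ≤ ((q : ℝ) ^ (b - a) - 2) * ((q : ℝ) ^ a + (q : ℝ) ^ b) := by gcongr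
          _ ≤ _ := by nlinarith
      have e5 := mul_le_mul_of_nonneg_right e4 (zero_le_one.trans e3.le)
      nlinarith)
  obtain ⟨w, hw0, hw⟩ := exists_pow_eq_of_mulChar_eq_one hχ hl
  have hne : f l ≠ 0 := fun h => by
    rw [h, MulChar.map_zero] at hl
    exact zero_ne_one hl
  rw [hf] at hne hw
  simp only [eval_sub, eval_pow, eval_X] at hne hw
  have hA : l ^ q ^ a - l ≠ 0 := fun h => hne (by rw [h, zero_mul, mul_zero])
  have hB : l ^ q ^ b - l ≠ 0 := fun h => hne (by rw [h, inv_zero, mul_zero, mul_zero])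
  refine ⟨l, w, hw0, sub_ne_zero.1 hA, sub_ne_zero.1 hB, ?_⟩
  rw [hw, mul_assoc, inv_mul_cancel_right₀ hB]

end FrobeniusRatio

section Scattered

variable {q : ℕ} {Fq Fqn : Type*} [Field Fq] [Fintype Fq] [Field Fqn] [Algebra Fq Fqn]

theorem not_isScattered_Uspace [FiniteDimensional Fq Fqn] (hq : Fintype.card Fq = q)
    {α β γ : Fqn} {I J : ℕ} {l x y : Fqn} (hl : ∀ c : Fq, algebraMap Fq Fqn c ≠ l) (hy : y ≠ 0)
    (h₁ : (l ^ q ^ I - l) * x ^ q ^ I + α * ((l ^ q ^ J - l) * y ^ q ^ J) = 0)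
    (h₂ : (l ^ q ^ J - l) * x ^ q ^ J + β * ((l ^ q ^ I - l) * y ^ q ^ I) +
      γ * ((l ^ q ^ J - l) * y ^ q ^ J) = 0) :
    ¬ IsScattered Fq (Uspace q Fq hq α β γ I J) := by
  intro hscat
  set u := Uvec q α β γ I J x y with hu
  have hu1 : u 1 = y := rfl
  have hu0 : u ≠ 0 := fun h => hy (by rw [← hu1, h, Pi.zero_apply])
  have hlu : l • u = Uvec q α β γ I J (l * x) (l * y) := by
    funext i
    fin_cases i
    · rfl
    · rfl
    · simp only [hu, Uvec, Pi.smul_apply, smul_eq_mul, mul_pow, Fin.reduceFinMk, Matrix.cons_val]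
      linear_combination -h₁
    · simp only [hu, Uvec, Pi.smul_apply, smul_eq_mul, mul_pow, Fin.reduceFinMk, Matrix.cons_val]
      linear_combination -h₂
  have hle := hscat (Submodule.span Fqn {u}) (finrank_span_singleton hu0)
  obtain ⟨v, hv⟩ := (finrank_le_one_iff).1 hle
  obtain ⟨c, hc⟩ := hv ⟨u, ⟨x, y, rfl⟩, Submodule.mem_span_singleton_self u⟩
  obtain ⟨d, hd⟩ := hv ⟨l • u, ⟨l * x, l * y, hlu⟩,
    Submodule.smul_mem _ l (Submodule.mem_span_singleton_self u)⟩
  have hc1 : algebraMap Fq Fqn c * (v : Fin 4 → Fqn) 1 = y := by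
    rw [← Algebra.smul_def, ← hu1]
    exact congrFun (congrArg Subtype.val hc) 1
  have hd1 : algebraMap Fq Fqn d * (v : Fin 4 → Fqn) 1 = l * y := by
    rw [← Algebra.smul_def, ← hu1]
    exact congrFun (congrArg Subtype.val hd) 1
  have hc0 : algebraMap Fq Fqn c ≠ 0 := fun h => hy (by rw [← hc1, h, zero_mul])
  have hv0 : (v : Fin 4 → Fqn) 1 ≠ 0 := fun h => hy (by rw [← hc1, h, mul_zero])
  refine hl (d / c) ?_
  rw [map_div₀, div_eq_iff hc0]
  apply mul_right_cancel₀ hv0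
  rw [hd1, mul_assoc, hc1]

theorem exists_pow_pow_eq [Fintype Fqn] {n i : ℕ} (hF : Fintype.card Fqn = q ^ n) (hi : i ≤ n)
    (w : Fqn) : ∃ y, y ^ q ^ i = w := by
  refine ⟨w ^ q ^ (n - i), ?_⟩
  rw [← pow_mul, ← pow_add, Nat.sub_add_cancel hi, ← hF, FiniteField.pow_card]

end Scattered

/-- Assume gcd(I,J,n) = 1 and max{I,J} ≤ n/4.  If the F_q-subspace
U^{I,J,n}_{α,β,γ} of F_{q^n}^4 is scattered, then P^{I,J}_{α,β,γ}(X) has no roots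
in F_{q^n}. -/
theorem PHasNoRoot_of_scattered
    (q n : ℕ) (Fq Fqn : Type*) [Field Fq] [Fintype Fq] [Field Fqn] [Algebra Fq Fqn]
    (hq : Fintype.card Fq = q) (hrank : Module.finrank Fq Fqn = n)
    (α β γ : Fqn) (hα : α ≠ 0) (hβ : β ≠ 0) (hγ : γ ≠ 0)
    (I J : ℕ) (hI : 0 < I) (hJ : 0 < J) (hIJ : I ≠ J) (hIn : I < n - 1) (hJn : J < n - 1)
    (hgcd : Nat.gcd (Nat.gcd I J) n = 1)
    (hmax : 4 * max I J ≤ n)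
    (hscat : IsScattered Fq (Uspace q Fq hq α β γ I J)) :
    PHasNoRoot q α β γ I J := by
  have hn : 0 < n := by omega
  have : FiniteDimensional Fq Fqn := Module.finite_of_finrank_pos (hrank ▸ hn)
  have : Finite Fqn := Module.finite_of_finite Fq
  have := Fintype.ofFinite Fqn
  have hF : Fintype.card Fqn = q ^ n := by
    rw [Module.card_eq_pow_finrank (K := Fq), hq, hrank]
  have hq2 : 2 ≤ q := hq ▸ Fintype.one_lt_card
  have hαβ : α * β ≠ 0 := mul_ne_zero hα hβ
  have hsub : ∀ {l : Fqn} {i : ℕ}, l ^ q ^ i ≠ l → ∀ c : Fq, algebraMap Fq Fqn c ≠ l :=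
    fun hl c hc => hl (by rw [← hc, frob_algebraMap q Fq hq])
  unfold PHasNoRoot
  rcases lt_or_gt_of_ne hIJ with h | h
  · rw [if_pos h]
    intro z hz
    set σ := q ^ (J - I) with hσ
    have hσ0 : σ - 1 + 1 = σ := Nat.sub_add_cancel (Nat.one_le_pow _ _ (by omega))
    have hIσ : q ^ J = q ^ I * σ := by rw [hσ, ← pow_add, Nat.add_sub_cancel' h.le]
    have hz0 : z ≠ 0 := fun h0 => hαβ (by rw [h0] at hz; simpa using hz)
    obtain ⟨l, w, hw0, hlI, hlJ, hw⟩ := exists_frobenius_ratio hq2 hF hI h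
      (by omega) (div_ne_zero (neg_ne_zero.2 hz0) hα)
    rw [← hσ] at hw
    obtain ⟨y, hy⟩ := exists_pow_pow_eq hF (by omega : I ≤ n) w
    obtain ⟨x, hx⟩ := exists_pow_pow_eq hF (by omega : I ≤ n) (z * w)
    have hwσ : w ^ σ = w ^ (σ - 1) * w := by rw [← pow_succ, hσ0]
    have hy0 : y ≠ 0 := fun h0 => hw0 (by rw [← hy, h0, zero_pow (by positivity)])
    have hαw : α * (w ^ (σ - 1) * (l ^ q ^ J - l)) = -z * (l ^ q ^ I - l) := by
      rw [hw]; field_simp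
    refine not_isScattered_Uspace hq (hsub hlI) hy0 (x := x) ?_ ?_ hscat
    · rw [hIσ, pow_mul y, hx, hy, hwσ, ← hIσ]
      linear_combination w * hαw
    · have hIx : x ^ q ^ J = z ^ σ * w ^ σ := by rw [hIσ, pow_mul, hx, mul_pow]
      have hIy : y ^ q ^ J = w ^ σ := by rw [hIσ, pow_mul, hy]
      rw [hIx, hIy, hy, hwσ]
      apply mul_left_cancel₀ hα
      rw [pow_succ] at hz
      linear_combination w * (z ^ σ + γ) * hαw - w * (l ^ q ^ I - l) * hz
  · rw [if_neg h.not_gt]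
    intro z hz
    set σ := q ^ (I - J) with hσ
    have hσ0 : σ - 1 + 1 = σ := Nat.sub_add_cancel (Nat.one_le_pow _ _ (by omega))
    have hJσ : q ^ I = q ^ J * σ := by rw [hσ, ← pow_add, Nat.add_sub_cancel' h.le]
    rw [pow_succ] at hz
    have hz0 : z + γ ≠ 0 := fun h0 => hαβ (by linear_combination z ^ σ * h0 - hz)
    obtain ⟨l, w, hw0, hlJ, hlI, hw⟩ := exists_frobenius_ratio hq2 hF hJ h
      (by omega) (div_ne_zero (neg_ne_zero.2 hz0) hβ)
    rw [← hσ] at hw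
    obtain ⟨y, hy⟩ := exists_pow_pow_eq hF (by omega : J ≤ n) w
    obtain ⟨x, hx⟩ := exists_pow_pow_eq hF (by omega : J ≤ n) (z * w)
    have hwσ : w ^ σ = w ^ (σ - 1) * w := by rw [← pow_succ, hσ0]
    have hy0 : y ≠ 0 := fun h0 => hw0 (by rw [← hy, h0, zero_pow (by positivity)])
    have hβw : β * (w ^ (σ - 1) * (l ^ q ^ I - l)) = -(z + γ) * (l ^ q ^ J - l) := by
      rw [hw]; field_simp
    have hIx : x ^ q ^ I = z ^ σ * w ^ σ := by rw [hJσ, pow_mul, hx, mul_pow]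
    have hIy : y ^ q ^ I = w ^ σ := by rw [hJσ, pow_mul, hy]
    refine not_isScattered_Uspace hq (hsub hlI) hy0 (x := x) ?_ ?_ hscat
    · rw [hIx, hy, hwσ]
      apply mul_left_cancel₀ hβ
      linear_combination w * z ^ σ * hβw - w * (l ^ q ^ J - l) * hz
    · rw [hIy, hx, hy, hwσ]
      linear_combination w * hβw
end

section
/- If the polynomial P^{I,J}_{α,β,γ}(X) has no roots in F_{q^n}, then the F_q-subspace U^{I,J,n}_{α,β,γ} of F_{q^n}^4 is (2, 2·max{I,J})-evasive; that is, for every 2-dimensional F_{q^n}-subspace H of F_{q^n}^4, dim_{F_q}(U^{I,J,n}_{α,β,γ} ∩ H) ≤ 2·max{I, J}. -/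
open Module

open ScatteredSeq Module

namespace ScatteredSeq

section Twist

variable (q : ℕ) (Fq : Type*) [Field Fq] [Fintype Fq] {Fqn : Type*} [Field Fqn]
  [Algebra Fq Fqn]

/-- The `F_q`-linear map `x ↦ x ^ q ^ k`. -/
def twist (hq : Fintype.card Fq = q) (k : ℕ) : Fqn →ₗ[Fq] Fqn where
  toFun x := x ^ q ^ k
  map_add' := frob_add q Fq hq k
  map_smul' c x := by
    simp [Algebra.smul_def, mul_pow, frob_algebraMap q Fq hq]

@[simp] theorem twist_apply (hq : Fintype.card Fq = q) (k : ℕ) (x : Fqn) : twist q Fq hq k x = x ^ q ^ k := rfl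

theorem span_range_twist (hq : Fintype.card Fq = q)
    [FiniteDimensional Fq Fqn] :
    Submodule.span Fqn (Set.range fun k : ℕ => twist (Fqn := Fqn) q Fq hq k) = ⊤ := by
  have : Finite Fqn := Module.finite_of_finite Fq
  have hli := linearIndependent_toLinearMap Fq Fqn Fqn
  have hcard : Fintype.card (Fqn →ₐ[Fq] Fqn) = finrank Fqn (Fqn →ₗ[Fq] Fqn) := by
    rw [finrank_linearMap_self, ← IsGalois.card_aut_eq_finrank Fq Fqn, ← Nat.card_eq_fintype_card]
    exact Nat.card_congr (algEquivEquivAlgHom Fq Fqn).toEquiv.symm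
  rw [eq_top_iff, ← hli.span_eq_top_of_card_eq_finrank hcard, Submodule.span_le]
  rintro _ ⟨σ, rfl⟩
  obtain ⟨k, hk⟩ := (FiniteField.bijective_frobeniusAlgHom_pow Fq Fqn).2 σ
  refine Submodule.subset_span ⟨k, ?_⟩
  ext x
  subst hk hq
  simp [FiniteField.coe_frobeniusAlgHom, pow_iterate]

variable {V : Type*} [AddCommGroup V] [Module Fq V]

theorem twist_comp_mem_of_mem_span (hq : Fintype.card Fq = q)
    {ι : Type*} (Z : ι → V →ₗ[Fq] Fqn) (M : ℕ)
    (W : Submodule Fqn (V →ₗ[Fq] Fqn))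
    (hW : W = Submodule.span Fqn
      (Set.range fun p : ι × Fin M => twist q Fq hq p.2 ∘ₗ Z p.1))
    (hM : ∀ i, twist q Fq hq M ∘ₗ Z i ∈ W) (f : V →ₗ[Fq] Fqn) (hf : f ∈ W) :
    twist q Fq hq 1 ∘ₗ f ∈ W := by
  rw [hW] at hf
  induction hf using Submodule.span_induction with
  | mem f hf =>
    obtain ⟨⟨i, k⟩, rfl⟩ := hf
    have h : twist q Fq hq 1 ∘ₗ twist q Fq hq k ∘ₗ Z i = twist q Fq hq (k + 1) ∘ₗ Z i := by
      ext v
      simp [← pow_mul, pow_succ]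
    dsimp only
    rw [h]
    rcases (Nat.succ_le_iff.2 k.2).lt_or_eq with hk | hk
    · rw [hW]
      exact Submodule.subset_span ⟨(i, ⟨k + 1, hk⟩), rfl⟩
    · rw [show (k : ℕ) + 1 = M from hk]
      exact hM i
  | zero => simp
  | add f g _ _ hf hg => rw [LinearMap.comp_add]; exact W.add_mem hf hg
  | smul c f _ hf =>
    have h : twist q Fq hq 1 ∘ₗ (c • f) = (c ^ q) • (twist q Fq hq 1 ∘ₗ f) := by
      ext v
      simp [mul_pow]
    rw [h]
    exact W.smul_mem _ hf

/-- If the `q ^ M`-th powers of a jointly injective family of `F_q`-linear functions on `V` are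
`F_{q^n}`-combinations of the lower powers, then `V` has dimension at most `M` times the size of
the family. -/
theorem finrank_le_card_mul (hq : Fintype.card Fq = q)
    [FiniteDimensional Fq Fqn] [FiniteDimensional Fq V]
    {ι : Type*} [Fintype ι] (Z : ι → V →ₗ[Fq] Fqn)
    (hZ : ∀ v, (∀ i, Z i v = 0) → v = 0) (M : ℕ)
    (hM : ∀ i, twist q Fq hq M ∘ₗ Z i ∈ Submodule.span Fqn
      (Set.range fun p : ι × Fin M => twist q Fq hq p.2 ∘ₗ Z p.1)) :
    finrank Fq V ≤ Fintype.card ι * M := by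
  classical
  obtain ⟨W, hW⟩ : ∃ W, W = Submodule.span Fqn
      (Set.range fun p : ι × Fin M => twist q Fq hq p.2 ∘ₗ Z p.1) := ⟨_, rfl⟩
  rw [← hW] at hM
  have hstep := twist_comp_mem_of_mem_span q Fq hq Z M W hW hM
  have htwist (i : ι) (k : ℕ) : twist q Fq hq k ∘ₗ Z i ∈ W := by
    induction k with
    | zero =>
      rcases M.eq_zero_or_pos with rfl | h
      · exact hM i
      · rw [hW]
        exact Submodule.subset_span ⟨(i, ⟨0, h⟩), rfl⟩
    | succ k ih =>
      convert hstep _ ih using 1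
      ext v
      simp [← pow_mul, pow_succ]
  have hcomp (i : ι) (g : Fqn →ₗ[Fq] Fqn) : g ∘ₗ Z i ∈ W := by
    have hg : g ∈ Submodule.span Fqn (Set.range fun k : ℕ => twist (Fqn := Fqn) q Fq hq k) := by
      rw [span_range_twist]; trivial
    induction hg using Submodule.span_induction with
    | mem f hf => obtain ⟨k, rfl⟩ := hf; exact htwist i k
    | zero => simp
    | add f g _ _ hf hg => rw [LinearMap.add_comp]; exact W.add_mem hf hg
    | smul c f _ hf => rw [LinearMap.smul_comp]; exact W.smul_mem _ hf
  have htop : W = ⊤ := by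
    rw [eq_top_iff]
    intro f _
    have hker : LinearMap.ker (LinearMap.pi Z) = ⊥ := by
      rw [LinearMap.ker_eq_bot']
      exact fun v hv => hZ v fun i => congrFun hv i
    obtain ⟨g, hg⟩ := LinearMap.exists_leftInverse_of_injective _ hker
    have hf : f = ∑ i, (f ∘ₗ g ∘ₗ LinearMap.single Fq (fun _ => Fqn) i) ∘ₗ Z i := by
      ext v
      have hv : g (LinearMap.pi Z v) = v := LinearMap.congr_fun hg v
      conv_lhs => rw [← hv, ← Finset.univ_sum_single (LinearMap.pi Z v)]
      simp
    rw [hf]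
    exact W.sum_mem fun i _ => hcomp i _
  rw [← finrank_linearMap_self Fq Fqn V, ← finrank_top, ← htop, hW]
  exact (finrank_range_le_card _).trans (by simp)

theorem finrank_le_of_pow_eq_smul (hq : Fintype.card Fq = q)
    [FiniteDimensional Fq Fqn] [FiniteDimensional Fq V]
    (X : V →ₗ[Fq] Fqn) (hX : ∀ v, X v = 0 → v = 0) {I J : ℕ} (hI : 0 < I) (hIJ : I < J)
    (a b e : Fqn) (hab : a ≠ 0 ∨ b ≠ 0)
    (h : ∀ v, a * X v ^ q ^ I + b * X v ^ q ^ J = e * X v) : finrank Fq V ≤ J := by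
  have key (M : ℕ) (hM : twist q Fq hq M ∘ₗ X ∈ Submodule.span Fqn
      (Set.range fun p : Unit × Fin M => twist q Fq hq p.2 ∘ₗ X)) : finrank Fq V ≤ M := by
    simpa using finrank_le_card_mul q Fq hq (fun _ : Unit => X) (fun v hv => hX v (hv ()))
      M (fun _ => hM)
  have mem {M k : ℕ} (hk : k < M) : twist q Fq hq k ∘ₗ X ∈ Submodule.span Fqn
      (Set.range fun p : Unit × Fin M => twist q Fq hq p.2 ∘ₗ X) :=
    Submodule.subset_span ⟨((), ⟨k, hk⟩), rfl⟩
  by_cases hb : b = 0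
  · have ha : a ≠ 0 := by simpa [hb] using hab
    refine (key I ?_).trans hIJ.le
    convert Submodule.smul_mem _ (a⁻¹ * e) (mem hI) using 1
    ext v
    simp only [LinearMap.comp_apply, twist_apply, LinearMap.smul_apply, smul_eq_mul, pow_zero,
      pow_one]
    rw [mul_assoc, ← h v, hb]
    field_simp
    ring
  · refine key J ?_
    convert Submodule.sub_mem _ (Submodule.smul_mem _ (b⁻¹ * e) (mem (hI.trans hIJ)))
      (Submodule.smul_mem _ (b⁻¹ * a) (mem hIJ)) using 1
    ext v
    simp only [LinearMap.comp_apply, twist_apply, LinearMap.smul_apply, LinearMap.sub_apply,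
      smul_eq_mul, pow_zero, pow_one]
    rw [mul_assoc, ← h v]
    field_simp
    ring

theorem finrank_le_max_of_pow_eq_smul (hq : Fintype.card Fq = q)
    [FiniteDimensional Fq Fqn] [FiniteDimensional Fq V]
    (X : V →ₗ[Fq] Fqn) (hX : ∀ v, X v = 0 → v = 0) {I J : ℕ} (hI : 0 < I) (hJ : 0 < J)
    (hIJ : I ≠ J) (a b e : Fqn) (hab : a ≠ 0 ∨ b ≠ 0)
    (h : ∀ v, a * X v ^ q ^ I + b * X v ^ q ^ J = e * X v) : finrank Fq V ≤ max I J := by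
  rcases hIJ.lt_or_gt with hlt | hlt
  · exact (finrank_le_of_pow_eq_smul q Fq hq X hX hI hlt a b e hab h).trans (le_max_right _ _)
  · exact (finrank_le_of_pow_eq_smul q Fq hq X hX hJ hlt b a e hab.symm
      fun v => by rw [add_comm, h v]).trans (le_max_left _ _)

theorem finrank_le_two_mul_max (hq : Fintype.card Fq = q)
    [FiniteDimensional Fq Fqn] [FiniteDimensional Fq V]
    (X Y : V →ₗ[Fq] Fqn) (hXY : ∀ v, X v = 0 → Y v = 0 → v = 0) {I J : ℕ} (hI : 0 < I)
    (hJ : 0 < J) (hIJ : I ≠ J) {α β : Fqn} (γ a b c d : Fqn) (hα : α ≠ 0) (hβ : β ≠ 0)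
    (h₁ : ∀ v, X v ^ q ^ I + α * Y v ^ q ^ J = a * X v + b * Y v)
    (h₂ : ∀ v, X v ^ q ^ J + β * Y v ^ q ^ I + γ * Y v ^ q ^ J = c * X v + d * Y v) :
    finrank Fq V ≤ 2 * max I J := by
  obtain ⟨M, hM⟩ : ∃ M, M = max I J := ⟨_, rfl⟩
  rw [← hM]
  let Z : Fin 2 → V →ₗ[Fq] Fqn := ![X, Y]
  obtain ⟨W, hW⟩ : ∃ W, W = Submodule.span Fqn
      (Set.range fun p : Fin 2 × Fin M => twist q Fq hq p.2 ∘ₗ Z p.1) := ⟨_, rfl⟩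
  have memX {k : ℕ} (hk : k < M) : twist q Fq hq k ∘ₗ X ∈ W := by
    rw [hW]; exact Submodule.subset_span ⟨(0, ⟨k, hk⟩), rfl⟩
  have memY {k : ℕ} (hk : k < M) : twist q Fq hq k ∘ₗ Y ∈ W := by
    rw [hW]; exact Submodule.subset_span ⟨(1, ⟨k, hk⟩), rfl⟩
  have hM0 : 0 < M := hM ▸ hI.trans_le (le_max_left _ _)
  suffices h : twist q Fq hq M ∘ₗ X ∈ W ∧ twist q Fq hq M ∘ₗ Y ∈ W by
    simpa using finrank_le_card_mul q Fq hq Z (fun v hv => hXY v (hv 0) (hv 1)) M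
      (by rw [← hW]; exact Fin.forall_fin_two.2 h)
  rcases hIJ.lt_or_gt with hlt | hlt
  · obtain rfl : M = J := hM.trans (max_eq_right hlt.le)
    have hY : twist q Fq hq M ∘ₗ Y ∈ W := by
      convert W.smul_mem α⁻¹ (W.sub_mem (W.add_mem (W.smul_mem a (memX hM0))
        (W.smul_mem b (memY hM0))) (memX hlt)) using 1
      ext v
      simp [← h₁ v, hα]
    refine ⟨?_, hY⟩
    convert W.sub_mem (W.sub_mem (W.add_mem (W.smul_mem c (memX hM0))
      (W.smul_mem d (memY hM0))) (W.smul_mem β (memY hlt))) (W.smul_mem γ hY) using 1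
    ext v
    simp [← h₂ v]
    ring
  · obtain rfl : M = I := hM.trans (max_eq_left hlt.le)
    constructor
    · convert W.sub_mem (W.add_mem (W.smul_mem a (memX hM0))
        (W.smul_mem b (memY hM0))) (W.smul_mem α (memY hlt)) using 1
      ext v
      simp [← h₁ v]
    · convert W.smul_mem β⁻¹ (W.sub_mem (W.sub_mem (W.add_mem (W.smul_mem c (memX hM0))
        (W.smul_mem d (memY hM0))) (memX hlt)) (W.smul_mem γ (memY hlt))) using 1
      ext v
      simp [← h₂ v]
      field_simp
      ring

end Twist

theorem PHasNoRoot.ne_zero_or_ne_zero {q : ℕ} {F : Type*} [Field F] {α β γ : F} {I J : ℕ}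
    (hP : PHasNoRoot q α β γ I J) {c d : F} (hcd : c ≠ 0 ∨ d ≠ 0) (t : F) (hq : q ≠ 0) :
    c + d * β * t ^ q ^ I ≠ 0 ∨ c * α * t ^ q ^ J + d + d * γ * t ^ q ^ J ≠ 0 := by
  by_contra! h
  obtain ⟨h₁, h₂⟩ := h
  have hc : c = -(d * β * t ^ q ^ I) := eq_neg_of_add_eq_zero_left h₁
  have hd : d ≠ 0 := by
    rintro rfl
    simp_all
  have ht : t ≠ 0 := by
    rintro rfl
    simp [hq] at h₂
    exact hd h₂
  have h : 1 + γ * t ^ q ^ J - α * β * (t ^ q ^ I * t ^ q ^ J) = 0 := by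
    apply mul_left_cancel₀ hd
    rw [hc] at h₂
    linear_combination h₂
  have hroot : t⁻¹ ^ q ^ I * t⁻¹ ^ q ^ J + γ * t⁻¹ ^ q ^ I - α * β = 0 := by
    have hI := pow_ne_zero (q ^ I) ht
    have hJ := pow_ne_zero (q ^ J) ht
    simp only [inv_pow]
    field_simp
    linear_combination h
  unfold PHasNoRoot at hP
  split_ifs at hP with hlt
  · refine hP (t⁻¹ ^ q ^ I) ?_
    rw [pow_succ, ← pow_mul, ← pow_add q, Nat.add_sub_cancel' hlt.le]
    linear_combination hroot
  · refine hP (t⁻¹ ^ q ^ J) ?_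
    rw [pow_succ, ← pow_mul, ← pow_add q, Nat.add_sub_cancel' (not_lt.1 hlt)]
    linear_combination hroot

section Plane

variable {K : Type*} [Field K] {V : Type*} [AddCommGroup V] [Module K V]

theorem exists_eq_smul_add_smul (hV : finrank K V = 2) {f g : V →ₗ[K] K}
    (hfg : LinearIndependent K ![f, g]) (h : V →ₗ[K] K) :
    ∃ a b : K, h = a • f + b • g := by
  have : FiniteDimensional K V := .of_finrank_pos (by omega)
  have htop := hfg.span_eq_top_of_card_eq_finrank (by
    rw [finrank_linearMap_self, hV, Fintype.card_fin])
  have hh : h ∈ Submodule.span K (Set.range ![f, g]) := htop ▸ Submodule.mem_top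
  rw [Matrix.range_cons, Matrix.range_cons, Matrix.range_empty, Set.union_empty,
    Set.singleton_union, Submodule.mem_span_pair] at hh
  obtain ⟨a, b, hab⟩ := hh
  exact ⟨a, b, hab.symm⟩

theorem exists_smul_add_smul_eq_smul (hV : finrank K V = 2) {f : V →ₗ[K] K} (hf : f ≠ 0)
    (g h : V →ₗ[K] K) :
    ∃ c d e : K, (c ≠ 0 ∨ d ≠ 0) ∧ c • g + d • h = e • f := by
  by_cases hfg : LinearIndependent K ![f, g]
  · obtain ⟨a, b, hab⟩ := exists_eq_smul_add_smul hV hfg h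
    exact ⟨-b, 1, a, .inr one_ne_zero, by rw [hab]; module⟩
  · rw [LinearIndependent.pair_iff' hf] at hfg
    push Not at hfg
    obtain ⟨a, ha⟩ := hfg
    exact ⟨1, 0, a, .inl one_ne_zero, by rw [ha]; module⟩

end Plane

end ScatteredSeq

/-- If P^{I,J}_{α,β,γ}(X) has no roots in F_{q^n}, then the
F_q-subspace U^{I,J,n}_{α,β,γ} of F_{q^n}^4 is (2, 2·max{I,J})-evasive: every
2-dimensional F_{q^n}-subspace H of F_{q^n}^4 satisfies
dim_{F_q}(U ∩ H) ≤ 2·max{I,J}. -/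
theorem Uspace_evasive
    (q n : ℕ) (Fq Fqn : Type*) [Field Fq] [Fintype Fq] [Field Fqn] [Algebra Fq Fqn]
    (hq : Fintype.card Fq = q) (hrank : Module.finrank Fq Fqn = n)
    (α β γ : Fqn) (hα : α ≠ 0) (hβ : β ≠ 0) (hγ : γ ≠ 0)
    (I J : ℕ) (hI : 0 < I) (hJ : 0 < J) (hIJ : I ≠ J) (hIn : I < n - 1) (hJn : J < n - 1)
    (hP : PHasNoRoot q α β γ I J) :
    ∀ H : Submodule Fqn (Fin 4 → Fqn), Module.finrank Fqn H = 2 →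
      Module.finrank Fq ↥(Uspace q Fq hq α β γ I J ⊓ H.restrictScalars Fq)
        ≤ 2 * max I J := by
  intro H hH
  have : FiniteDimensional Fq Fqn := .of_finrank_pos (by omega)
  have hq0 : q ≠ 0 := by subst hq; exact Fintype.card_ne_zero
  let S := Uspace q Fq hq α β γ I J ⊓ H.restrictScalars Fq
  let p (i : Fin 4) : H →ₗ[Fqn] Fqn := LinearMap.proj i ∘ₗ H.subtype
  let P (i : Fin 4) : S →ₗ[Fq] Fqn := LinearMap.proj i ∘ₗ S.subtype
  have h₂ (v : S) : P 2 v = P 0 v ^ q ^ I + α * P 1 v ^ q ^ J := by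
    obtain ⟨_, ⟨x, y, rfl⟩, -⟩ := v
    rfl
  have h₃ (v : S) : P 3 v = P 0 v ^ q ^ J + β * P 1 v ^ q ^ I + γ * P 1 v ^ q ^ J := by
    obtain ⟨_, ⟨x, y, rfl⟩, -⟩ := v
    rfl
  have hinj (v : S) (hv₀ : P 0 v = 0) (hv₁ : P 1 v = 0) : v = 0 := by
    have hv₂ := h₂ v
    have hv₃ := h₃ v
    simp only [hv₀, hv₁, zero_pow (pow_ne_zero _ hq0), mul_zero, add_zero] at hv₂ hv₃
    ext i
    fin_cases i
    exacts [hv₀, hv₁, hv₂, hv₃]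
  by_cases hli : LinearIndependent Fqn ![p 0, p 1]
  · obtain ⟨a, b, hab⟩ := exists_eq_smul_add_smul hH hli (p 2)
    obtain ⟨c, d, hcd⟩ := exists_eq_smul_add_smul hH hli (p 3)
    refine finrank_le_two_mul_max q Fq hq (P 0) (P 1) hinj hI hJ hIJ γ a b c d hα hβ
      (fun v => ?_) (fun v => ?_)
    · rw [← h₂]; exact LinearMap.congr_fun hab ⟨v.1, v.2.2⟩
    · rw [← h₃]; exact LinearMap.congr_fun hcd ⟨v.1, v.2.2⟩
  suffices h : finrank Fq S ≤ max I J from h.trans (by omega)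
  by_cases hp₀ : p 0 = 0
  · have hP₀ (v : S) : P 0 v = 0 := LinearMap.congr_fun hp₀ ⟨v.1, v.2.2⟩
    by_cases hp₁ : p 1 = 0
    · have hP₁ (v : S) : P 1 v = 0 := LinearMap.congr_fun hp₁ ⟨v.1, v.2.2⟩
      have : Subsingleton S := subsingleton_of_forall_eq 0 fun v => hinj v (hP₀ v) (hP₁ v)
      rw [finrank_zero_of_subsingleton]
      exact Nat.zero_le _
    · obtain ⟨c, d, e, hcd, h⟩ := exists_smul_add_smul_eq_smul hH hp₁ (p 2) (p 3)
      refine finrank_le_max_of_pow_eq_smul q Fq hq (P 1) (fun v => hinj v (hP₀ v)) hI hJ hIJ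
        (d * β) (c * α + d * γ) e ?_ fun v => ?_
      · by_cases hd : d = 0
        · right; simp_all
        · left; exact mul_ne_zero hd hβ
      · have hv : c * P 2 v + d * P 3 v = e * P 1 v := LinearMap.congr_fun h ⟨v.1, v.2.2⟩
        rw [h₂, h₃, hP₀] at hv
        simp only [zero_pow (pow_ne_zero _ hq0)] at hv
        linear_combination hv
  · rw [LinearIndependent.pair_iff' hp₀] at hli
    push Not at hli
    obtain ⟨t, ht⟩ := hli
    have hP₁ (v : S) : P 1 v = t * P 0 v := (LinearMap.congr_fun ht ⟨v.1, v.2.2⟩).symm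
    obtain ⟨c, d, e, hcd, h⟩ := exists_smul_add_smul_eq_smul hH hp₀ (p 2) (p 3)
    refine finrank_le_max_of_pow_eq_smul q Fq hq (P 0)
      (fun v hv => hinj v hv (by rw [hP₁, hv, mul_zero])) hI hJ hIJ _ _ e
      (hP.ne_zero_or_ne_zero hcd t hq0) fun v => ?_
    have hv : c * P 2 v + d * P 3 v = e * P 0 v := LinearMap.congr_fun h ⟨v.1, v.2.2⟩
    rw [h₂, h₃, hP₁] at hv
    simp only [mul_pow] at hv
    linear_combination hv
end
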